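/- arXiv:2103.01508 — 3 statements merged into one kernel-verified Lean document; each statement's English description precedes it below -/
import Mathlib

section
/- For every integer k ≥ 2, the star-critical Gallai-Ramsey number gr_k^*(K_3 : C_4) equals k + 3; in particular, there exists a k-edge-coloring of K_{k+4} minus one edge with no rainbow triangle and no monochromatic C_4. -/
def RainbowTri {V : Type} {k : ℕ} (Adj : V → V → Prop) (c : V → V → Fin k) : Prop :=
  ∃ a b d : V, Adj a b ∧ Adj a d ∧ Adj b d ∧
    c a b ≠ c a d ∧ c a b ≠ c b d ∧ c a d ≠ c b d

def MonoTri {V : Type} {k : ℕ} (Adj : V → V → Prop) (c : V → V → Fin k) : Prop :=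
  ∃ a b d : V, a ≠ b ∧ a ≠ d ∧ b ≠ d ∧ Adj a b ∧ Adj a d ∧ Adj b d ∧
    c a b = c a d ∧ c a d = c b d

def MonoP4 {V : Type} {k : ℕ} (Adj : V → V → Prop) (c : V → V → Fin k) : Prop :=
  ∃ a b d e : V, a ≠ b ∧ a ≠ d ∧ a ≠ e ∧ b ≠ d ∧ b ≠ e ∧ d ≠ e ∧
    Adj a b ∧ Adj b d ∧ Adj d e ∧ c a b = c b d ∧ c b d = c d e

def MonoC4 {V : Type} {k : ℕ} (Adj : V → V → Prop) (c : V → V → Fin k) : Prop :=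
  ∃ a b d e : V, a ≠ b ∧ a ≠ d ∧ a ≠ e ∧ b ≠ d ∧ b ≠ e ∧ d ≠ e ∧
    Adj a b ∧ Adj b d ∧ Adj d e ∧ Adj e a ∧
    c a b = c b d ∧ c b d = c d e ∧ c d e = c e a

def MonoClique {V : Type} {k : ℕ} [DecidableEq V] (Adj : V → V → Prop)
    (c : V → V → Fin k) (p : ℕ) (i : Fin k) : Prop :=
  ∃ S : Finset V, S.card = p ∧ ∀ a ∈ S, ∀ b ∈ S, a ≠ b → Adj a b ∧ c a b = i

def MonoStar {V : Type} {k : ℕ} [DecidableEq V] (Adj : V → V → Prop)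
    (c : V → V → Fin k) (m : ℕ) (i : Fin k) : Prop :=
  ∃ v : V, ∃ S : Finset V, S.card = m ∧ v ∉ S ∧ ∀ u ∈ S, Adj v u ∧ c v u = i

def Full {V : Type} : V → V → Prop := fun a b => a ≠ b

def OAdj {m : ℕ} (A : Finset (Fin m)) : Option (Fin m) → Option (Fin m) → Prop
  | some i, some j => i ≠ j
  | some i, none   => i ∈ A
  | none,   some j => j ∈ A
  | none,   none   => False

def IsGallaiPartition {n k q : ℕ} (c : Fin n → Fin n → Fin k)
    (P : Fin q → Finset (Fin n)) : Prop :=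
  2 ≤ q ∧ (∀ i, (P i).Nonempty) ∧ (∀ i j, i ≠ j → Disjoint (P i) (P j)) ∧
  (∀ x : Fin n, ∃ i, x ∈ P i) ∧
  (∀ i j, i ≠ j → ∃ col : Fin k, ∀ a ∈ P i, ∀ b ∈ P j, c a b = col) ∧
  (∃ c1 c2 : Fin k, ∀ i j, i ≠ j → ∀ a ∈ P i, ∀ b ∈ P j, c a b = c1 ∨ c a b = c2)

def MonoCopy {W V : Type} {k : ℕ} (H : SimpleGraph W) (Adj : V → V → Prop)
    (c : V → V → Fin k) (i : Fin k) : Prop :=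
  ∃ φ : W → V, Function.Injective φ ∧
    ∀ a b, H.Adj a b → Adj (φ a) (φ b) ∧ c (φ a) (φ b) = i

def MonoMergeCopy {W V : Type} {k : ℕ} (H : SimpleGraph W)
    (c : V → V → Fin k) (i : Fin k) : Prop :=
  ∃ φ : W → V, ∀ a b, H.Adj a b → φ a ≠ φ b ∧ c (φ a) (φ b) = i

/-- The relation `r` contains no 4-cycle. -/
def C4Free {V : Type} (r : V → V → Prop) : Prop :=
  ∀ x y z w : V, x ≠ y → x ≠ z → x ≠ w → y ≠ z → y ≠ w → z ≠ w →
    r x y → r y z → r z w → r w x → False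

/-- Among six vertices, a vertex with three `r`-neighbours forces a 4-cycle in `r` or in its
complement. -/
theorem C4Free.not_three_neighbours {V : Type} {r : V → V → Prop} (hs : ∀ x y, r x y → r y x)
    (hr : C4Free r) (hb : C4Free fun x y => ¬ r x y) {v a b c d e : V}
    (hva : v ≠ a) (hvb : v ≠ b) (hvc : v ≠ c) (hvd : v ≠ d) (hve : v ≠ e)
    (hab : a ≠ b) (hac : a ≠ c) (had : a ≠ d) (hae : a ≠ e) (hbc : b ≠ c) (hbd : b ≠ d)
    (hbe : b ≠ e) (hcd : c ≠ d) (hce : c ≠ e) (hde : d ≠ e)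
    (rva : r v a) (rvb : r v b) (rvc : r v c) : False := by
  have hs' : ∀ x y, r x y ↔ r y x := fun x y => ⟨hs x y, hs y x⟩
  have twoCommon : ∀ x y z, v ≠ x → v ≠ y → v ≠ z → x ≠ y → x ≠ z → y ≠ z →
      r v x → r v y → ¬ (r x z ∧ r y z) := fun x y z h1 h2 h3 h4 h5 h6 rx ry h =>
    hr v x z y h1 h3 h2 h5 h4 h6.symm rx h.1 (hs _ _ h.2) (hs _ _ ry)
  have t1 := twoCommon a b c hva hvb hvc hab hac hbc rva rvb
  have t2 := twoCommon a c b hva hvc hvb hac hab hbc.symm rva rvc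
  have t3 := twoCommon b c a hvb hvc hva hbc hab.symm hac.symm rvb rvc
  have t4 := twoCommon a b d hva hvb hvd hab had hbd rva rvb
  have t5 := twoCommon a c d hva hvc hvd hac had hcd rva rvc
  have t6 := twoCommon b c d hvb hvc hvd hbc hbd hcd rvb rvc
  have t7 := twoCommon a b e hva hvb hve hab hae hbe rva rvb
  have t8 := twoCommon a c e hva hvc hve hac hae hce rva rvc
  have t9 := twoCommon b c e hvb hvc hve hbc hbe hce rvb rvc
  have p1 := hr a b d e hab had hae hbd hbe hde
  have p2 := hr a b e d hab hae had hbe hbd hde.symm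
  have p3 := hr a c d e hac had hae hcd hce hde
  have p4 := hr a c e d hac hae had hce hcd hde.symm
  have p5 := hr b c d e hbc hbd hbe hcd hce hde
  have p6 := hr b c e d hbc hbe hbd hce hcd hde.symm
  have q1 := hb a b d e hab had hae hbd hbe hde
  have q2 := hb a b e d hab hae had hbe hbd hde.symm
  have q3 := hb a c d e hac had hae hcd hce hde
  have q4 := hb a c e d hac hae had hce hcd hde.symm
  have q5 := hb b c d e hbc hbd hbe hcd hce hde
  have q6 := hb b c e d hbc hbe hbd hce hcd hde.symm
  have k1 := hb a d b e had hab hae hbd.symm hde hbe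
  have k2 := hb a d c e had hac hae hcd.symm hde hce
  have k3 := hb b d c e hbd hbc hbe hcd.symm hde hce
  have s1 := hb a b c d hab hac had hbc hbd hcd
  have s2 := hb a b d c hab had hac hbd hbc hcd.symm
  have s3 := hb a c b d hac hab had hbc.symm hcd hbd
  have s4 := hb a b c e hab hac hae hbc hbe hce
  have s5 := hb a b e c hab hae hac hbe hbc hce.symm
  have s6 := hb a c b e hac hab hae hbc.symm hce hbe
  simp only [hs' b a, hs' c a, hs' d a, hs' e a, hs' c b, hs' d b, hs' e b, hs' d c, hs' e c,
    hs' e d] at *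
  clear twoCommon hr hb hs hs'
  grind

/-- A relation that is 4-cycle free together with its complement lives on at most 5 vertices:
`R(C₄, C₄) ≤ 6`. -/
theorem C4Free.card_le_five {V : Type} [DecidableEq V] {r : V → V → Prop}
    (hs : ∀ x y, r x y → r y x) (hr : C4Free r) (hb : C4Free fun x y => ¬ r x y)
    (S : Finset V) : S.card ≤ 5 := by
  classical
  by_contra! hS
  obtain ⟨v, hv⟩ : S.Nonempty := Finset.card_pos.1 (by omega)
  have hT : 5 ≤ (S.erase v).card := by rw [Finset.card_erase_of_mem hv]; omega
  have key : ∀ q : V → V → Prop, (∀ x y, q x y → q y x) → C4Free q →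
      C4Free (fun x y => ¬ q x y) → ¬ 2 < ((S.erase v).filter (q v)).card := by
    intro q hq h1 h2 h3
    obtain ⟨a, ha, b, hb, c, hc, hab, hac, hbc⟩ := Finset.two_lt_card.1 h3
    have h4 : 1 < ((S.erase v) \ {a, b, c}).card := by
      have := Finset.le_card_sdiff {a, b, c} (S.erase v)
      have := Finset.card_le_three (a := a) (b := b) (c := c)
      omega
    obtain ⟨d, hd, e, he, hde⟩ := Finset.one_lt_card.1 h4
    simp only [Finset.mem_filter, Finset.mem_erase, Finset.mem_sdiff, Finset.mem_insert,
      Finset.mem_singleton, not_or] at ha hb hc hd he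
    exact h1.not_three_neighbours hq h2 ha.1.1.symm hb.1.1.symm hc.1.1.symm hd.1.1.symm
      he.1.1.symm hab hac (Ne.symm hd.2.1) (Ne.symm he.2.1) hbc (Ne.symm hd.2.2.1)
      (Ne.symm he.2.2.1) (Ne.symm hd.2.2.2) (Ne.symm he.2.2.2) hde ha.2 hb.2 hc.2
  have h1 := key r hs hr hb
  have h2 := key (fun x y => ¬ r x y) (fun x y h h' => h (hs _ _ h')) hb
    (by simpa only [not_not] using hr)
  have := Finset.card_filter_add_card_filter_not (s := S.erase v) (r v)
  have : ((S.erase v).filter fun y => ¬ r v y).card ≤ 2 := by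
    convert Nat.le_of_not_lt h2
  omega

section Gallai

variable {V : Type} [DecidableEq V] {k : ℕ} {c : V → V → Fin k}

/-- In a Gallai colouring without monochromatic 4-cycle, a vertex set has a vertex joined to all
the others in one colour, or only two colours occur in it. -/
theorem exists_mono_vertex_or_two_colors [Nonempty (Fin k)] (hs : ∀ a b, c a b = c b a)
    (hR : ¬ RainbowTri Full c) (hC : ¬ MonoC4 Full c) (S : Finset V) :
    (∃ v ∈ S, ∃ i, ∀ u ∈ S, u ≠ v → c v u = i) ∨
      (∃ i j, ∀ u ∈ S, ∀ w ∈ S, u ≠ w → c u w = i ∨ c u w = j) := by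
  have tri : ∀ a b d, a ≠ b → a ≠ d → b ≠ d →
      c a b = c a d ∨ c a b = c b d ∨ c a d = c b d := by
    intro a b d h1 h2 h3
    by_contra! h
    exact hR ⟨a, b, d, h1, h2, h3, h⟩
  have common : ∀ i a b x y, a ≠ b → x ≠ y → a ≠ x → a ≠ y → b ≠ x → b ≠ y →
      c a x = i → c a y = i → c b x = i → c b y = i → False := by
    intro i a b x y h1 h2 h3 h4 h5 h6 e1 e2 e3 e4
    exact hC ⟨a, x, b, y, h3, h1, h4, h5.symm, h2, h6, h3, h5.symm, h6, h4.symm,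
      by rw [e1, hs x b, e3], by rw [e4, hs x b, e3], by rw [e4, hs y a, e2]⟩
  induction S using Finset.induction_on with
  | empty => exact Or.inr ⟨Classical.arbitrary _, Classical.arbitrary _, by simp⟩
  | insert x T hx ih =>
    rcases ih with ⟨v, hv, i, hi⟩ | ⟨i, j, hij⟩
    · have hvx : v ≠ x := by rintro rfl; exact hx hv
      by_cases hj : c v x = i
      · exact Or.inl ⟨v, by simp [hv], i, by grind⟩
      by_cases hall : ∀ u ∈ T, c x u = c v x
      · exact Or.inl ⟨x, by simp, c v x, by grind⟩
      push Not at hall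
      obtain ⟨r, hr, hxr⟩ := hall
      have hrx : r ≠ x := by rintro rfl; exact hx hr
      have hrv : r ≠ v := by rintro rfl; exact hxr (hs _ _)
      have hxri : c x r = i := by
        have := tri v x r hvx hrv.symm hrx.symm
        grind
      have hxs : ∀ s ∈ T, s ≠ v → s ≠ r → c x s = c v x := by
        intro s hsT hsv hsr
        have hsx : s ≠ x := by rintro rfl; exact hx hsT
        have := tri v x s hvx hsv.symm hsx.symm
        have := common i v x r s hvx hsr.symm hrv.symm hsv.symm hrx.symm hsx.symm
        grind
      have hrs : ∀ s ∈ T, s ≠ v → s ≠ r → c r s = i ∨ c r s = c v x := by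
        intro s hsT hsv hsr
        have hsx : s ≠ x := by rintro rfl; exact hx hsT
        have := tri x r s hrx.symm hsx.symm hsr.symm
        grind
      refine Or.inr ⟨i, c v x, ?_⟩
      have hss : ∀ s ∈ T, ∀ t ∈ T, s ≠ v → s ≠ r → t ≠ v → t ≠ r → s ≠ t →
          c s t = i ∨ c s t = c v x := by
        intro s hsT t htT hsv hsr htv htr hst
        have hsx : s ≠ x := by rintro rfl; exact hx hsT
        have htx : t ≠ x := by rintro rfl; exact hx htT
        have h1 := hrs s hsT hsv hsr
        have h2 := hrs t htT htv htr
        have h3 := common i v r s t hrv.symm hst hsv.symm htv.symm hsr.symm htr.symm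
          (hi s hsT hsv) (hi t htT htv)
        have h4 := common (c v x) x r s t hrx.symm hst hsx.symm htx.symm hsr.symm htr.symm
          (hxs s hsT hsv hsr) (hxs t htT htv htr)
        have h5 := tri r s t hsr.symm htr.symm hst
        grind
      have hxw : ∀ w ∈ T, c x w = i ∨ c x w = c v x := by
        intro w hw
        by_cases hwv : w = v
        · exact Or.inr (hwv ▸ hs _ _)
        by_cases hwr : w = r
        · exact Or.inl (hwr ▸ hxri)
        exact Or.inr (hxs w hw hwv hwr)
      have hrw : ∀ w ∈ T, w ≠ r → c r w = i ∨ c r w = c v x := by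
        intro w hw hwr
        by_cases hwv : w = v
        · subst hwv
          exact Or.inl (by rw [hs, hi r hr hrv])
        exact hrs w hw hwv hwr
      intro u hu w hw huw
      rw [Finset.mem_insert] at hu hw
      rcases hu with rfl | hu
      · exact hxw w (hw.resolve_left huw.symm)
      rcases hw with rfl | hw
      · rw [hs u]
        exact hxw u hu
      by_cases huv : u = v
      · subst huv
        exact Or.inl (hi w hw huw.symm)
      by_cases hwv : w = v
      · subst hwv
        exact Or.inl (by rw [hs, hi u hu huw])
      by_cases hur : u = r
      · subst hur
        exact hrw w hw huw.symm
      by_cases hwr : w = r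
      · subst hwr
        rw [hs u]
        exact hrw u hu huw
      exact hss u hu w hw huv hur hwv hwr huw
    · by_cases hG : ∀ u ∈ T, c x u = i ∨ c x u = j
      · refine Or.inr ⟨i, j, ?_⟩
        grind
      push Not at hG
      obtain ⟨g, hg, hgi, hgj⟩ := hG
      left
      have hgx : g ≠ x := by rintro rfl; exact hx hg
      have hN : ∀ y ∈ T, c x y ≠ c x g → (c x y = i ∨ c x y = j) ∧
          ∀ h ∈ T, c x h = c x g → c y h = c x y := by
        intro y hy hyg
        have hyx : y ≠ x := by rintro rfl; exact hx hy
        have aux : ∀ h ∈ T, c x h = c x g → c y h = c x y := by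
          intro h hh hhg
          have hhx : h ≠ x := by rintro rfl; exact hx hh
          have hhy : h ≠ y := by rintro rfl; exact hyg hhg
          have := tri x y h hyx.symm hhx.symm hhy.symm
          have := hij y hy h hh hhy.symm
          grind
        refine ⟨?_, aux⟩
        have := hij y hy g hg (by rintro rfl; exact hyg rfl)
        rwa [aux g hg rfl] at this
      have hinj : ∀ y ∈ T, ∀ z ∈ T, y ≠ z → c x y ≠ c x g → c x z ≠ c x g →
          c x y ≠ c x z := by
        intro y hy z hz hyz hyg hzg heq
        have hyx : y ≠ x := by rintro rfl; exact hx hy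
        have hzx : z ≠ x := by rintro rfl; exact hx hz
        exact common (c x y) y z x g hyz hgx.symm hyx (by rintro rfl; exact hyg rfl) hzx
          (by rintro rfl; exact hzg rfl) (hs _ _) ((hN y hy hyg).2 g hg rfl)
          (by rw [hs, heq]) (by rw [(hN z hz hzg).2 g hg rfl, heq])
      by_cases h0 : ∀ u ∈ T, c x u = c x g
      · exact ⟨x, by simp, c x g, by grind⟩
      push Not at h0
      obtain ⟨y, hy, hyg⟩ := h0
      by_cases h1 : ∀ u ∈ T, u ≠ y → c x u = c x g
      · refine ⟨y, by simp [hy], c x y, ?_⟩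
        have := (hN y hy hyg).2
        grind
      push Not at h1
      obtain ⟨z, hz, hzy, hzg⟩ := h1
      have hyz := hinj y hy z hz hzy.symm hyg hzg
      have hrest : ∀ u ∈ T, u ≠ y → u ≠ z → c x u = c x g := by
        intro u hu huy huz
        by_contra hug
        have := hinj y hy u hu huy.symm hyg hug
        have := hinj z hz u hu huz.symm hzg hug
        have := (hN y hy hyg).1
        have := (hN z hz hzg).1
        have := (hN u hu hug).1
        grind
      have hyzc : c y z = c x y ∨ c y z = c x z := by
        have := (hN y hy hyg).1
        have := (hN z hz hzg).1
        have := hij y hy z hz hzy.symm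
        grind
      have hy2 := (hN y hy hyg).2
      have hz2 := (hN z hz hzg).2
      rcases hyzc with h | h
      · exact ⟨y, by simp [hy], c x y, by grind⟩
      · exact ⟨z, by simp [hz], c x z, by grind⟩

/-- If the colours in `U` form matchings on `S`, then `|S| + |U| ≤ k + 3`. -/
theorem card_add_card_matching_colors_le (hk : 2 ≤ k) (hs : ∀ a b, c a b = c b a)
    (hR : ¬ RainbowTri Full c) (hC : ¬ MonoC4 Full c) (n : ℕ) :
    ∀ (S : Finset V) (U : Finset (Fin k)), S.card = n →
      (∀ i ∈ U, ∀ a ∈ S, ∀ b ∈ S, ∀ d ∈ S, a ≠ b → a ≠ d → b ≠ d → c a b = i → c b d = i →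
        False) → S.card + U.card ≤ k + 3 := by
  have : Nonempty (Fin k) := ⟨⟨0, by omega⟩⟩
  have cyc : ∀ i a b d e, a ≠ b → a ≠ d → a ≠ e → b ≠ d → b ≠ e → d ≠ e →
      c a b = i → c b d = i → c d e = i → c e a = i → False := by
    intro i a b d e h1 h2 h3 h4 h5 h6 e1 e2 e3 e4
    exact hC ⟨a, b, d, e, h1, h2, h3, h4, h5, h6, h1, h4, h6, h3.symm, by rw [e1, e2],
      by rw [e2, e3], by rw [e3, e4]⟩
  induction n with
  | zero =>
    intro S U hS _
    have := Finset.card_le_univ U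
    simp only [Fintype.card_fin] at this
    omega
  | succ n ih =>
    intro S U hS hU
    have hUk := Finset.card_le_univ U
    simp only [Fintype.card_fin] at hUk
    by_cases h4 : S.card ≤ 3
    · omega
    rcases exists_mono_vertex_or_two_colors hs hR hC S with ⟨v, hv, i, hi⟩ | ⟨i, j, hij⟩
    · have hcard := Finset.card_erase_of_mem hv
      have hiU : i ∉ U := by
        intro hiU
        obtain ⟨a, ha, b, hb, hab⟩ := Finset.one_lt_card.1 (show 1 < (S.erase v).card by omega)
        rw [Finset.mem_erase] at ha hb
        exact hU i hiU a ha.2 v hv b hb.2 ha.1 hab hb.1.symm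
          (by rw [hs]; exact hi a ha.2 ha.1) (hi b hb.2 hb.1)
      have := ih (S.erase v) (insert i U) (by omega) (by
        intro l hl a ha b hb d hd hab had hbd e1 e2
        rw [Finset.mem_erase] at ha hb hd
        rcases Finset.mem_insert.1 hl with rfl | hl
        · exact cyc l v a b d ha.1.symm hb.1.symm hd.1.symm hab had hbd (hi a ha.2 ha.1) e1 e2
            (by rw [hs]; exact hi d hd.2 hd.1)
        · exact hU l hl a ha.2 b hb.2 d hd.2 hab had hbd e1 e2)
      rw [Finset.card_insert_of_notMem hiU] at this
      omega
    · obtain ⟨a, ha, b, hb, d, hd, e, he, hab, had, hae, hbd, hbe, hde⟩ :=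
        Finset.three_lt_card.1 (show 3 < S.card by omega)
      have hfour : ∀ l m, (∀ u ∈ S, ∀ w ∈ S, u ≠ w → c u w = l ∨ c u w = m) → l ∉ U := by
        intro l m hlm hl
        have path : ∀ x ∈ S, ∀ y ∈ S, ∀ z ∈ S, x ≠ y → x ≠ z → y ≠ z →
            c x y ≠ l ∨ c y z ≠ l := by
          intro x hx y hy z hz h1 h2 h3
          by_contra! h
          exact hU l hl x hx y hy z hz h1 h2 h3 h.1 h.2
        have p1 := path b hb a ha d hd hab.symm hbd had
        have p2 := path b hb a ha e he hab.symm hbe hae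
        have p3 := path d hd a ha e he had.symm hde hae
        have p4 := path a ha b hb d hd hab had hbd
        have p5 := path a ha b hb e he hab hae hbe
        have p6 := path d hd b hb e he hbd.symm hde hbe
        have p7 := path a ha d hd b hb had hab hbd.symm
        have p8 := path a ha d hd e he had hae hde
        have p9 := path b hb d hd e he hbd hbe hde
        have p10 := path a ha e he b hb hae hab hbe.symm
        have p11 := path a ha e he d hd hae had hde.symm
        have p12 := path b hb e he d hd hbe hbd hde.symm
        have c1 := cyc m a b d e hab had hae hbd hbe hde
        have c2 := cyc m a b e d hab hae had hbe hbd hde.symm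
        have c3 := cyc m a d b e had hab hae hbd.symm hde hbe
        have e1 := hlm a ha b hb hab
        have e2 := hlm a ha d hd had
        have e3 := hlm a ha e he hae
        have e4 := hlm b hb d hd hbd
        have e5 := hlm b hb e he hbe
        have e6 := hlm d hd e he hde
        rw [hs b a, hs d a, hs e a, hs d b, hs e b, hs e d] at *
        clear path cyc hlm hU ih hij hR hC
        grind
      have hiU := hfour i j hij
      have hjU := hfour j i fun u hu w hw huw => (hij u hu w hw huw).symm
      have hne : i ≠ j := by
        rintro rfl
        have mono : ∀ u ∈ S, ∀ w ∈ S, u ≠ w → c u w = i := fun u hu w hw huw =>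
          (hij u hu w hw huw).elim id id
        exact cyc i a b d e hab had hae hbd hbe hde (mono a ha b hb hab) (mono b hb d hd hbd)
          (mono d hd e he hde) (mono e he a ha hae.symm)
      have hcard : (insert i (insert j U)).card = U.card + 2 := by
        rw [Finset.card_insert_of_notMem (by simp [hne, hiU]), Finset.card_insert_of_notMem hjU]
      have hUk' := Finset.card_le_univ (insert i (insert j U))
      rw [Fintype.card_fin, hcard] at hUk'
      have inj : ∀ {x y : S}, x ≠ y → (x : V) ≠ y := fun h h' => h (Subtype.ext h')
      have h5 := C4Free.card_le_five (r := fun x y : S => c x y = i)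
        (fun x y h => by rw [hs, h])
        (fun x y z w h1 h2 h3 h4 h5 h6 => cyc i x y z w (inj h1) (inj h2) (inj h3) (inj h4)
          (inj h5) (inj h6))
        (fun x y z w h1 h2 h3 h4 h5 h6 e1 e2 e3 e4 =>
          cyc j x y z w (inj h1) (inj h2) (inj h3) (inj h4) (inj h5) (inj h6)
            ((hij x x.2 y y.2 (inj h1)).resolve_left e1)
            ((hij y y.2 z z.2 (inj h4)).resolve_left e2)
            ((hij z z.2 w w.2 (inj h6)).resolve_left e3)
            ((hij w w.2 x x.2 (inj h3).symm).resolve_left e4)) Finset.univ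
      rw [Finset.card_univ, Fintype.card_coe] at h5
      omega

end Gallai

/-- A 2-colouring of `K₆` in which `0 — 5` is the only edge on monochromatic 4-cycles. -/
def sixColor (x y : ℕ) : ℕ :=
  if (min x y, max x y) ∈ [(0, 3), (0, 4), (1, 2), (1, 4), (1, 5), (2, 3), (2, 5)] then 0 else 1

/-- `sixColor` on the first six vertices, each later vertex being joined to all earlier ones in a
new colour. -/
def towerColor (x y : ℕ) : ℕ := if 6 ≤ max x y then max x y - 4 else sixColor x y

theorem towerColor_comm (x y : ℕ) : towerColor x y = towerColor y x := by
  simp [towerColor, sixColor, max_comm, min_comm]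

theorem sixColor_lt_two (x y : ℕ) : sixColor x y < 2 := by
  unfold sixColor
  split_ifs <;> omega

theorem towerColor_not_rainbow (a b d : ℕ) : towerColor a b = towerColor a d ∨
    towerColor a b = towerColor b d ∨ towerColor a d = towerColor b d := by
  have h1 := sixColor_lt_two a b
  have h2 := sixColor_lt_two a d
  have h3 := sixColor_lt_two b d
  unfold towerColor
  split_ifs <;> omega

/-- Adjacency in the complete graph on `ℕ` without the edge `0 — 5`. -/
def TowerAdj (x y : ℕ) : Prop := x ≠ y ∧ ¬ (x = 0 ∧ y = 5) ∧ ¬ (x = 5 ∧ y = 0)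

instance (x y : ℕ) : Decidable (TowerAdj x y) := by
  unfold TowerAdj
  infer_instance

theorem sixColor_not_mono_C4 : ∀ a b d e : Fin 6, ¬ (a ≠ d ∧ b ≠ e ∧
    TowerAdj a b ∧ TowerAdj b d ∧ TowerAdj d e ∧ TowerAdj e a ∧
    sixColor a b = sixColor b d ∧ sixColor b d = sixColor d e ∧ sixColor d e = sixColor e a) := by
  decide

theorem towerColor_not_mono_C4 {a b d e : ℕ} (had : a ≠ d) (hbe : b ≠ e) (hab : TowerAdj a b)
    (hbd : TowerAdj b d) (hde : TowerAdj d e) (hea : TowerAdj e a)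
    (h1 : towerColor a b = towerColor b d) (h2 : towerColor b d = towerColor d e) :
    towerColor d e ≠ towerColor e a := by
  intro h3
  by_cases hsmall : a < 6 ∧ b < 6 ∧ d < 6 ∧ e < 6
  · obtain ⟨ha, hb, hd, he⟩ := hsmall
    have hlt : ∀ {x y : ℕ}, x < 6 → y < 6 → towerColor x y = sixColor x y := fun hx hy =>
      if_neg (by omega)
    rw [hlt ha hb, hlt hb hd] at h1
    rw [hlt hb hd, hlt hd he] at h2
    rw [hlt hd he, hlt he ha] at h3
    exact sixColor_not_mono_C4 ⟨a, ha⟩ ⟨b, hb⟩ ⟨d, hd⟩ ⟨e, he⟩ ⟨fun h => had (Fin.ext_iff.1 h),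
      fun h => hbe (Fin.ext_iff.1 h), hab, hbd, hde, hea, h1, h2, h3⟩
  · have := sixColor_lt_two a b
    have := sixColor_lt_two b d
    have := sixColor_lt_two d e
    have := sixColor_lt_two e a
    have := hab.1
    have := hbd.1
    have := hde.1
    have := hea.1
    unfold towerColor at h1 h2 h3
    split_ifs at h1 h2 h3 <;> omega

/-- The vertices of `K_m` and one further vertex, which is sent to `5`, as natural numbers. -/
def towerIndex {m : ℕ} : Option (Fin m) → ℕ
  | none => 5
  | some i => if i.val < 5 then i.val else i.val + 1

theorem towerIndex_injective {m : ℕ} : Function.Injective (towerIndex (m := m)) := by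
  rintro (_ | i) (_ | j) h
  · rfl
  · simp only [towerIndex] at h
    split_ifs at h <;> omega
  · simp only [towerIndex] at h
    split_ifs at h <;> omega
  · simp only [towerIndex] at h
    rw [Option.some.injEq, Fin.ext_iff]
    split_ifs at h <;> omega

theorem towerAdj_towerIndex {k : ℕ} : ∀ {x y : Option (Fin (k + 3))},
    OAdj (Finset.univ.erase 0) x y → TowerAdj (towerIndex x) (towerIndex y)
  | none, none => fun h => h.elim
  | none, some j => fun h => by
    have : j.val ≠ 0 := fun h0 => (Finset.mem_erase.1 h).1 (Fin.ext h0)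
    simp only [towerIndex, TowerAdj]
    split_ifs <;> simp only [false_and, true_and, and_false, not_false_eq_true, and_true] <;> omega
  | some i, none => fun h => by
    have : i.val ≠ 0 := fun h0 => (Finset.mem_erase.1 h).1 (Fin.ext h0)
    simp only [towerIndex, TowerAdj]
    split_ifs <;> simp only [and_false, not_false_eq_true, and_true] <;> omega
  | some i, some j => fun h => by
    have : i.val ≠ j.val := fun h0 => h (Fin.ext h0)
    simp only [towerIndex, TowerAdj]
    split_ifs <;> omega

theorem towerColor_towerIndex_lt {k : ℕ} (hk : 2 ≤ k) (x y : Option (Fin (k + 3))) :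
    towerColor (towerIndex x) (towerIndex y) < k := by
  have hle : ∀ z : Option (Fin (k + 3)), towerIndex z < k + 4 := by
    rintro (_ | i)
    · simp only [towerIndex]
      omega
    · simp only [towerIndex]
      split_ifs <;> omega
  have hx := hle x
  have hy := hle y
  have := sixColor_lt_two (towerIndex x) (towerIndex y)
  unfold towerColor
  split_ifs <;> omega

/-- `K_{k+4}` minus an edge has a Gallai `k`-colouring without monochromatic 4-cycle. -/
theorem exists_coloring_missing_edge (k : ℕ) (hk : 2 ≤ k) :
    ∃ A : Finset (Fin (k + 3)), A.card = k + 2 ∧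
      ∃ c : Option (Fin (k + 3)) → Option (Fin (k + 3)) → Fin k,
        (∀ a b, c a b = c b a) ∧ ¬ RainbowTri (OAdj A) c ∧ ¬ MonoC4 (OAdj A) c := by
  refine ⟨Finset.univ.erase 0, by simp, fun x y => ⟨_, towerColor_towerIndex_lt hk x y⟩,
    fun a b => Fin.ext (towerColor_comm _ _), ?_, ?_⟩
  · rintro ⟨a, b, d, -, -, -, h1, h2, h3⟩
    simp only [ne_eq, Fin.mk.injEq] at h1 h2 h3
    have := towerColor_not_rainbow (towerIndex a) (towerIndex b) (towerIndex d)
    tauto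
  · rintro ⟨a, b, d, e, -, had, -, -, hbe, -, hab, hbd, hde, hea, h1, h2, h3⟩
    simp only [Fin.mk.injEq] at h1 h2 h3
    exact towerColor_not_mono_C4 (towerIndex_injective.ne had) (towerIndex_injective.ne hbe)
      (towerAdj_towerIndex hab) (towerAdj_towerIndex hbd) (towerAdj_towerIndex hde)
      (towerAdj_towerIndex hea) h1 h2 h3

theorem OAdj.mono {m : ℕ} {A B : Finset (Fin m)} (h : A ⊆ B) :
    ∀ {x y : Option (Fin m)}, OAdj A x y → OAdj B x y
  | none, none => id
  | none, some _ => fun hj => h hj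
  | some _, none => fun hi => h hi
  | some _, some _ => id

theorem RainbowTri.mono {V : Type} {k : ℕ} {Adj Adj' : V → V → Prop} {c : V → V → Fin k}
    (h : ∀ {x y}, Adj x y → Adj' x y) : RainbowTri Adj c → RainbowTri Adj' c := by
  rintro ⟨a, b, d, hab, had, hbd, hc⟩
  exact ⟨a, b, d, h hab, h had, h hbd, hc⟩

theorem MonoC4.mono {V : Type} {k : ℕ} {Adj Adj' : V → V → Prop} {c : V → V → Fin k}
    (h : ∀ {x y}, Adj x y → Adj' x y) : MonoC4 Adj c → MonoC4 Adj' c := by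
  rintro ⟨a, b, d, e, h1, h2, h3, h4, h5, h6, hab, hbd, hde, hea, hc⟩
  exact ⟨a, b, d, e, h1, h2, h3, h4, h5, h6, h hab, h hbd, h hde, h hea, hc⟩

theorem OAdj.univ_of_ne {m : ℕ} : ∀ {x y : Option (Fin m)}, Full x y → OAdj Finset.univ x y
  | none, none => fun h => h rfl
  | none, some j => fun _ => Finset.mem_univ j
  | some i, none => fun _ => Finset.mem_univ i
  | some _, some _ => fun h h' => h (congrArg some h')

theorem stmt7 (k : ℕ) (hk : 2 ≤ k) :
    IsLeast {s | ∀ A : Finset (Fin (k + 3)), A.card = s →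
      ∀ c : Option (Fin (k + 3)) → Option (Fin (k + 3)) → Fin k,
        (∀ a b, c a b = c b a) →
        RainbowTri (OAdj A) c ∨ MonoC4 (OAdj A) c} (k + 3) ∧
    (∃ A : Finset (Fin (k + 3)), A.card = k + 2 ∧
      ∃ c : Option (Fin (k + 3)) → Option (Fin (k + 3)) → Fin k,
        (∀ a b, c a b = c b a) ∧
        ¬ RainbowTri (OAdj A) c ∧ ¬ MonoC4 (OAdj A) c) := by
  have lower := exists_coloring_missing_edge k hk
  refine ⟨⟨fun A hA c hs => ?_, fun s hs => ?_⟩, lower⟩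
  · obtain rfl : A = Finset.univ := by
      rw [← Finset.card_eq_iff_eq_univ, hA, Fintype.card_fin]
    by_contra! h
    have := card_add_card_matching_colors_le hk hs (fun h' => h.1 (h'.mono OAdj.univ_of_ne))
      (fun h' => h.2 (h'.mono OAdj.univ_of_ne)) _ Finset.univ ∅ rfl (by simp)
    simp at this
  · by_contra! hlt
    obtain ⟨A, hA, c, hc, hR, hC⟩ := lower
    obtain ⟨B, hBA, hB⟩ := Finset.exists_subset_card_eq (show s ≤ A.card by omega)
    rcases hs B hB c hc with h | h
    · exact hR (h.mono (OAdj.mono hBA))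
    · exact hC (h.mono (OAdj.mono hBA))
end

section
/- For all integers m ≥ 3 and k ≥ 3, the Gallai-Ramsey number of the star satisfies gr_k(K_3 : K_{1,m}) = (5m-6)/2 if m is even and (5m-3)/2 if m is odd. -/
/-! ### A lower bound: blow-up of the 2-colored pentagon -/

/-- The 2-coloring of the complete graph on five vertices by two 5-cycles, the diagonal getting a
third color. -/
def pentagonColor (x y : Fin 5) : Fin 3 :=
  if x = y then 2 else if x + 1 = y ∨ y + 1 = x then 0 else 1

theorem pentagonColor_comm : ∀ x y, pentagonColor x y = pentagonColor y x := by
  decide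

theorem pentagonColor_not_rainbow : ∀ x y z, pentagonColor x y = pentagonColor x z ∨
    pentagonColor x y = pentagonColor y z ∨ pentagonColor x z = pentagonColor y z := by
  decide

theorem pentagonColor_neighbors : ∀ x i, ∃ e₁ e₂ : Fin 5, e₁ < e₂ ∧
    ∀ y, pentagonColor x y = i → y = e₁ ∨ y = e₂ := by
  decide

/-- Few numbers below `n` lie in two given residue classes modulo 5. -/
theorem card_two_residues_lt {n m : ℕ} (hm : 3 ≤ m)
    (hn : n < if Even m then (5 * m - 6) / 2 else (5 * m - 3) / 2)
    {e₁ e₂ : ℕ} (he : e₁ < e₂) (S : Finset (Fin n))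
    (hS : ∀ x ∈ S, (x : ℕ) % 5 = e₁ ∨ (x : ℕ) % 5 = e₂) : S.card < m := by
  have hbound : ∀ x ∈ S, 2 * ((x : ℕ) / 5) + (if (x : ℕ) % 5 = e₂ then 1 else 0) < m - 1 := by
    intro x hx
    have hxn := x.2
    have hxS := hS x hx
    by_cases h : Even m
    · rw [if_pos h] at hn
      obtain ⟨s, rfl⟩ := h
      split_ifs <;> omega
    · rw [if_neg h] at hn
      obtain ⟨s, rfl⟩ := Nat.not_even_iff_odd.1 h
      split_ifs <;> omega
  have hcard : S.card ≤ (Finset.range (m - 1)).card := by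
    refine Finset.card_le_card_of_injOn
      (fun x => 2 * ((x : ℕ) / 5) + (if (x : ℕ) % 5 = e₂ then 1 else 0)) ?_ ?_
    · intro x hx
      simpa using hbound x hx
    · intro x hx y hy hxy
      have h1 := hS x hx
      have h2 := hS y hy
      simp only at hxy
      ext
      split_ifs at hxy <;> omega
  rw [Finset.card_range] at hcard
  omega

/-- Below the Gallai-Ramsey number there is a coloring with neither a rainbow triangle nor a
monochromatic star. -/
theorem exists_coloring_of_lt {k m n : ℕ} (hk : 3 ≤ k) (hm : 3 ≤ m)
    (hn : n < if Even m then (5 * m - 6) / 2 else (5 * m - 3) / 2) :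
    ∃ c : Fin n → Fin n → Fin k, (∀ a b, c a b = c b a) ∧ ¬ RainbowTri Full c ∧
      ¬ ∃ i, MonoStar Full c m i := by
  let r : Fin n → Fin 5 := fun x => ⟨(x : ℕ) % 5, Nat.mod_lt _ (by norm_num)⟩
  refine ⟨fun x y => Fin.castLE hk (pentagonColor (r x) (r y)), ?_, ?_, ?_⟩
  · intro a b
    simp only [pentagonColor_comm (r a) (r b)]
  · rintro ⟨a, b, d, -, -, -, h1, h2, h3⟩
    rcases pentagonColor_not_rainbow (r a) (r b) (r d) with h | h | h
    · exact h1 (congrArg _ h)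
    · exact h2 (congrArg _ h)
    · exact h3 (congrArg _ h)
  · rintro ⟨i, v, S, hS, -, hc⟩
    have hne : S.Nonempty := Finset.card_pos.1 (by omega)
    obtain ⟨u, hu⟩ := hne
    obtain ⟨e₁, e₂, he, hnb⟩ := pentagonColor_neighbors (r v) (pentagonColor (r v) (r u))
    have hlt := card_two_residues_lt hm hn he S (by
      intro x hx
      have hxu : pentagonColor (r v) (r x) = pentagonColor (r v) (r u) :=
        Fin.castLE_injective hk ((hc x hx).2.trans (hc u hu).2.symm)
      rcases hnb _ hxu with h | h
      · exact Or.inl (congrArg Fin.val h)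
      · exact Or.inr (congrArg Fin.val h))
    omega

/-! ### Gallai's structure theorem -/

/-- In a coloring without rainbow triangles, a cut of `S` using only two colors refines to an
equivalence relation with at least two classes on `S`, any two of which are joined in a single one of
these two colors. -/
theorem exists_setoid_of_cut {V K : Type*} {c : V → V → K} (hc : ∀ a b, c a b = c b a)
    (hG : ∀ a b d, a ≠ b → a ≠ d → b ≠ d → c a b = c a d ∨ c a b = c b d ∨ c a d = c b d)
    {S X : Finset V} {R B : K} (hXS : X ⊆ S) (hX : X.Nonempty) (hY : ∃ y ∈ S, y ∉ X)
    (hcut : ∀ x ∈ X, ∀ y ∈ S, y ∉ X → c x y = R ∨ c x y = B) :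
    ∃ r : Setoid V, (∃ x ∈ S, ∃ y ∈ S, ¬ r x y) ∧
      (∀ x ∈ S, ∀ y ∈ S, ¬ r x y → c x y = R ∨ c x y = B) ∧
      (∀ x ∈ S, ∀ y ∈ S, ∀ z ∈ S, r y z → ¬ r x y → c x y = c x z) := by
  let E : V → V → Prop := fun x y => x ∈ S ∧ y ∈ S ∧ c x y ≠ R ∧ c x y ≠ B
  have hE : ∀ x ∈ S, ∀ y ∈ S, ¬ Relation.EqvGen E x y → c x y = R ∨ c x y = B := by
    intro x hx y hy hxy
    by_contra hcon
    rw [not_or] at hcon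
    exact hxy (.rel _ _ ⟨hx, hy, hcon.1, hcon.2⟩)
  refine ⟨Relation.EqvGen.setoid E, ?_, hE, ?_⟩
  · obtain ⟨x, hx⟩ := hX
    obtain ⟨y, hy, hyX⟩ := hY
    refine ⟨x, hXS hx, y, hy, fun hxy => ?_⟩
    have key : ∀ a b, Relation.EqvGen E a b → (a ∈ X ↔ b ∈ X) := by
      intro a b hab
      induction hab with
      | rel a b h =>
        obtain ⟨ha, hb, h1, h2⟩ := h
        constructor
        · intro haX
          by_contra hbX
          rcases hcut a haX b hb hbX with h | h <;> contradiction
        · intro hbX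
          by_contra haX
          rw [hc] at h1 h2
          rcases hcut b hbX a ha haX with h | h <;> contradiction
      | refl a => rfl
      | symm a b _ ih => exact ih.symm
      | trans a b d _ _ ih1 ih2 => exact ih1.trans ih2
    exact hyX ((key x y hxy).1 hx)
  · intro x hx y _ z _ hyz hxy
    have key : ∀ a b, Relation.EqvGen E a b → ¬ Relation.EqvGen E x a → c x a = c x b := by
      intro a b hab
      induction hab with
      | rel a b h =>
        intro hxa
        have hxb : ¬ Relation.EqvGen E x b := fun h' => hxa (h'.trans _ _ _ (.symm _ _ (.rel _ _ h)))
        obtain ⟨ha, hb, h1, h2⟩ := h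
        by_cases hab : a = b
        · rw [hab]
        have hxa' : x ≠ a := by rintro rfl; exact hxa (.refl _)
        have hxb' : x ≠ b := by rintro rfl; exact hxb (.refl _)
        rcases hG x a b hxa' hxb' hab with h | h | h
        · exact h
        · rcases hE x hx a ha hxa with h' | h' <;> simp_all
        · rcases hE x hx b hb hxb with h' | h' <;> simp_all
      | refl a => intro _; rfl
      | symm a b hab ih =>
        intro hxb
        exact (ih fun hxa => hxb (hxa.trans _ _ _ hab)).symm
      | trans a b d hab _ ih1 ih2 =>
        intro hxa
        exact (ih1 hxa).trans (ih2 fun hxb => hxa (hxb.trans _ _ _ (.symm _ _ hab)))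
    exact key y z hyz hxy

/-- **Gallai's theorem**, cut form: in a coloring without rainbow triangles some cut uses at most
two colors. -/
theorem exists_two_colored_cut {V K : Type*} {c : V → V → K} (hc : ∀ a b, c a b = c b a)
    (hG : ∀ a b d, a ≠ b → a ≠ d → b ≠ d → c a b = c a d ∨ c a b = c b d ∨ c a d = c b d)
    (S : Finset V) (hS : S.Nontrivial) :
    ∃ R B : K, ∃ X ⊆ S, X.Nonempty ∧ (∃ y ∈ S, y ∉ X) ∧
      ∀ x ∈ X, ∀ y ∈ S, y ∉ X → c x y = R ∨ c x y = B := by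
  classical
  induction S using Finset.induction_on with
  | empty => simp at hS
  | insert v S hvS ih =>
    have hSne : S.Nonempty := by
      rw [Finset.nonempty_iff_ne_empty]
      rintro rfl
      simp at hS
    obtain ⟨s, hs⟩ := hSne
    by_contra hno
    have hv3 : ∀ R B, ∃ x ∈ S, c v x ≠ R ∧ c v x ≠ B := by
      intro R B
      by_contra hcon
      push Not at hcon
      refine hno ⟨R, B, {v}, by simp, by simp, ⟨s, by simp [hs], ?_⟩, ?_⟩
      · rw [Finset.mem_singleton]
        rintro rfl
        exact hvS hs
      · intro x hx y hy hyx
        rw [Finset.mem_singleton] at hx hyx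
        subst hx
        have hyS : y ∈ S := (Finset.mem_insert.1 hy).resolve_left hyx
        exact or_iff_not_imp_left.2 (hcon y hyS)
    have hSnt : S.Nontrivial := by
      obtain ⟨x, hx, h1, _⟩ := hv3 (c v s) (c v s)
      exact ⟨s, hs, x, hx, by rintro rfl; exact h1 rfl⟩
    obtain ⟨R, B, X, hXS, hX, hY, hcut⟩ := ih hSnt
    obtain ⟨r, ⟨p, hp, q, hq, hpq⟩, hRB, hhom⟩ := exists_setoid_of_cut hc hG hXS hX hY hcut
    have hvne : ∀ x ∈ S, v ≠ x := by
      rintro x hx rfl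
      exact hvS hx
    have hother : ∀ x, ∃ z ∈ S, ¬ r x z := by
      intro x
      by_contra hcon
      push Not at hcon
      exact hpq (r.trans (r.symm (hcon p hp)) (hcon q hq))
    have hext : ∀ x ∈ S, ∃ y ∈ S, r x y ∧ c v y ≠ R ∧ c v y ≠ B := by
      intro x hx
      by_contra hcon
      push Not at hcon
      obtain ⟨z, hz, hxz⟩ := hother x
      refine hno ⟨R, B, S.filter (fun y => r x y), ?_, ⟨x, by simp [hx]⟩,
        ⟨z, by simp [hz], by simp [hxz]⟩, ?_⟩
      · exact (Finset.filter_subset _ _).trans (Finset.subset_insert _ _)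
      · intro y hy w hw hwn
        rw [Finset.mem_filter] at hy hwn
        rcases Finset.mem_insert.1 hw with rfl | hwS
        · rw [hc]
          exact or_iff_not_imp_left.2 (hcon y hy.1 hy.2)
        · exact hRB y hy.1 w hwS fun hyw => hwn ⟨hwS, r.trans hy.2 hyw⟩
    have htri : ∀ x ∈ S, ∀ y ∈ S, ¬ r x y → c v y ≠ R → c v y ≠ B →
        c v x = c v y ∨ c v x = c x y := by
      intro x hx y hy hxy h1 h2
      have hne : x ≠ y := by
        rintro rfl
        exact hxy (r.refl _)
      rcases hG v x y (hvne x hx) (hvne y hy) hne with h | h | h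
      · exact Or.inl h
      · exact Or.inr h
      · rcases hRB x hx y hy hxy with h' | h' <;> simp_all
    have hsame' : ∀ x ∈ S, ∀ y ∈ S, ¬ r x y → c v x ≠ R → c v x ≠ B → c v y ≠ R → c v y ≠ B →
        c v x = c v y := by
      intro x hx y hy hxy h1 h2 h3 h4
      rcases htri x hx y hy hxy h3 h4 with h | h
      · exact h
      · rcases hRB x hx y hy hxy with h' | h' <;> simp_all
    have hsame : ∀ x ∈ S, ∀ y ∈ S, c v x ≠ R → c v x ≠ B → c v y ≠ R → c v y ≠ B →
        c v x = c v y := by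
      intro x hx y hy h1 h2 h3 h4
      by_cases hxy : r x y
      · obtain ⟨z, hz, hxz⟩ := hother x
        obtain ⟨w, hw, hzw, h5, h6⟩ := hext z hz
        have hxw : ¬ r x w := fun h => hxz (r.trans h (r.symm hzw))
        have hyw : ¬ r y w := fun h => hxw (r.trans hxy h)
        exact (hsame' x hx w hw hxw h1 h2 h5 h6).trans (hsame' y hy w hw hyw h3 h4 h5 h6).symm
      · exact hsame' x hx y hy hxy h1 h2 h3 h4
    obtain ⟨y₀, hy₀, -, hy₀R, hy₀B⟩ := hext s hs
    obtain ⟨x, hx, hxR, hxg⟩ := hv3 R (c v y₀)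
    obtain ⟨x', hx', hxB', hxg'⟩ := hv3 B (c v y₀)
    have hxB : c v x = B := by
      by_contra h
      exact hxg (hsame x hx y₀ hy₀ hxR h hy₀R hy₀B)
    have hxR' : c v x' = R := by
      by_contra h
      exact hxg' (hsame x' hx' y₀ hy₀ h hxB' hy₀R hy₀B)
    by_cases hxx : r x x'
    · obtain ⟨z, hz, hxz⟩ := hother x
      obtain ⟨w, hw, hzw, h5, h6⟩ := hext z hz
      have hxw : ¬ r x w := fun h => hxz (r.trans h (r.symm hzw))
      have hxw' : ¬ r x' w := fun h => hxw (r.trans hxx h)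
      have e1 := (htri x hx w hw hxw h5 h6).resolve_left fun h => h6 (h.symm.trans hxB)
      have e2 := (htri x' hx' w hw hxw' h5 h6).resolve_left fun h => h5 (h.symm.trans hxR')
      have e3 := hhom w hw x hx x' hx' hxx fun h => hxw (r.symm h)
      rw [hc w x, hc w x', ← e1, ← e2, hxB] at e3
      exact hxB' e3.symm
    · obtain ⟨y, hy, hxy, hyR, hyB⟩ := hext x hx
      obtain ⟨y', hy', hxy', hyR', hyB'⟩ := hext x' hx'
      have n1 : ¬ r x y' := fun h => hxx (r.trans h (r.symm hxy'))
      have n2 : ¬ r x' y := fun h => hxx (r.trans hxy (r.symm h))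
      have e1 := (htri x hx y' hy' n1 hyR' hyB').resolve_left fun h => hyB' (h.symm.trans hxB)
      have e2 := (htri x' hx' y hy n2 hyR hyB).resolve_left fun h => hyR (h.symm.trans hxR')
      have e3 := hhom x hx x' hx' y' hy' hxy' hxx
      have e4 := hhom x' hx' x hx y hy hxy fun h => hxx (r.symm h)
      have : c v x = c v x' := by rw [e1, e2, ← e3, ← e4, hc]
      exact hxB' (this.symm.trans hxB)

/-! ### Weighted 2-colorings -/

section Weighted

open Classical in
/-- The total weight of the neighbors of `i` in color `b`. -/
noncomputable def weightedDegree {Q : Type*} [Fintype Q] (col : Q → Q → Bool) (a : Q → ℕ)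
    (i : Q) (b : Bool) : ℕ :=
  ∑ j with j ≠ i ∧ col i j = b, a j

variable {Q : Type*} [Fintype Q] {col : Q → Q → Bool} {a : Q → ℕ} {d : ℕ}

theorem add_weightedDegree (col : Q → Q → Bool) (a : Q → ℕ) (i : Q) :
    a i + weightedDegree col a i true + weightedDegree col a i false = ∑ j, a j := by
  classical
  unfold weightedDegree
  rw [Finset.sum_filter, Finset.sum_filter, add_assoc, ← Finset.sum_add_distrib,
    ← Finset.add_sum_erase _ a (Finset.mem_univ i), ← Finset.sum_erase (a := i) _ (by simp)]
  congr 1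
  refine Finset.sum_congr rfl fun j hj => ?_
  have := Finset.ne_of_mem_erase hj
  cases h : col i j <;> simp [this]

theorem le_weightedDegree {i j : Q} (hij : j ≠ i) : a j ≤ weightedDegree col a i (col i j) := by
  classical
  unfold weightedDegree
  exact Finset.single_le_sum (f := a) (fun _ _ => Nat.zero_le _) (by simp [hij])

theorem add_le_weightedDegree {i j l : Q} (hij : j ≠ i) (hil : l ≠ i) (hjl : j ≠ l)
    (h : col i j = col i l) : a j + a l ≤ weightedDegree col a i (col i l) := by
  classical
  unfold weightedDegree
  rw [← Finset.sum_pair (f := a) hjl]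
  refine Finset.sum_le_sum_of_subset fun x hx => ?_
  simp only [Finset.mem_insert, Finset.mem_singleton] at hx
  rcases hx with rfl | rfl <;> simp [*]

/-- If all weighted degrees are at most half the total weight, any two vertices have a common
monochromatic neighbor. -/
theorem exists_common_neighbor (hsymm : ∀ i j, col i j = col j i)
    (hd : ∀ i b, weightedDegree col a i b ≤ d) (hn : 2 * d < ∑ j, a j) {i j : Q} (hij : i ≠ j) :
    ∃ w, i ≠ w ∧ j ≠ w ∧ col w i = col w j := by
  classical
  by_contra hcon
  push Not at hcon
  have hsub : (Finset.univ : Finset Q) ⊆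
      (Finset.univ.filter fun w => w ≠ i ∧ col i w = col i j) ∪
        (Finset.univ.filter fun w => w ≠ j ∧ col j w = col i j) := by
    intro w _
    simp only [Finset.mem_union, Finset.mem_filter, Finset.mem_univ, true_and]
    by_cases h1 : w = i
    · subst h1
      exact Or.inr ⟨hij, hsymm _ _⟩
    by_cases h2 : w = j
    · subst h2
      exact Or.inl ⟨h1, rfl⟩
    have h3 := hcon w (Ne.symm h1) (Ne.symm h2)
    rw [hsymm w i, hsymm w j] at h3
    revert h3
    generalize col i w = p
    generalize col j w = q
    generalize col i j = t
    cases p <;> cases q <;> cases t <;> simp [h1, h2]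
  have h1 := Finset.sum_le_sum_of_subset (f := a) hsub
  have h2 := Finset.sum_union_inter (f := a)
    (s₁ := Finset.univ.filter fun w => w ≠ i ∧ col i w = col i j)
    (s₂ := Finset.univ.filter fun w => w ≠ j ∧ col j w = col i j)
  have h3 := hd i (col i j)
  have h4 := hd j (col i j)
  unfold weightedDegree at h3 h4
  omega

theorem add_le_of_weightedDegree_le (hsymm : ∀ i j, col i j = col j i)
    (hd : ∀ i b, weightedDegree col a i b ≤ d) (hn : 2 * d < ∑ j, a j) {i j : Q} (hij : i ≠ j) :
    a i + a j ≤ d := by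
  obtain ⟨w, h1, h2, h3⟩ := exists_common_neighbor hsymm hd hn hij
  exact (add_le_weightedDegree h1 h2 hij h3).trans (hd _ _)

theorem sum_ne_five_mul_add_one [Nontrivial Q] (hsymm : ∀ i j, col i j = col j i) {t : ℕ}
    (hd : ∀ i b, weightedDegree col a i b ≤ 2 * t) : ∑ j, a j ≠ 5 * t + 1 := by
  intro hn
  obtain ⟨i, j, hij⟩ := exists_pair_ne Q
  have h1 := add_le_of_weightedDegree_le hsymm hd (by omega) hij
  have h2 := add_weightedDegree col a i
  have h3 := add_weightedDegree col a j
  have := hd i true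
  have := hd i false
  have := hd j true
  have := hd j false
  omega

theorem sum_ne_of_three_le [Nontrivial Q] (hsymm : ∀ i j, col i j = col j i) {s : ℕ}
    (hs : 3 ≤ s) (hd : ∀ i b, weightedDegree col a i b ≤ 2 * s - 1) :
    ∑ j, a j ≠ 5 * s - 3 := by
  classical
  intro hn
  have hlow : ∀ i, s - 1 ≤ a i := by
    intro i
    have h2 := add_weightedDegree col a i
    have := hd i true
    have := hd i false
    omega
  have hupper : ∀ i M, (∀ j, j ≠ i → a j ≤ M) → ∀ b, weightedDegree col a i b ≤ 2 * M := by
    intro i M hM b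
    have hdi := hd i b
    obtain ⟨T, hT, hTi⟩ : ∃ T : Finset Q, weightedDegree col a i b = ∑ j ∈ T, a j ∧
        ∀ j ∈ T, j ≠ i := ⟨_, rfl, fun j hj => (Finset.mem_filter.1 hj).2.1⟩
    rw [hT] at hdi ⊢
    have h1 := (Finset.card_nsmul_le_sum T a (s - 1) fun j _ => hlow j).trans hdi
    have h2 := Finset.sum_le_card_nsmul T a M fun j hj => hM j (hTi j hj)
    rw [smul_eq_mul] at h1 h2
    have h3 : T.card ≤ 2 := by
      by_contra h
      have h4 : 3 * (s - 1) ≤ T.card * (s - 1) := Nat.mul_le_mul_right _ (by omega)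
      omega
    exact h2.trans (Nat.mul_le_mul_right M h3)
  obtain ⟨i, M, hM, hiM⟩ : ∃ i M, (∀ j, j ≠ i → a j ≤ M) ∧ a i + 4 * M < 5 * s - 3 := by
    by_cases h : ∃ i, s ≤ a i
    · obtain ⟨i, hi⟩ := h
      have hpair : ∀ j, j ≠ i → a i + a j ≤ 2 * s - 1 := fun j hj =>
        add_le_of_weightedDegree_le hsymm hd (by omega) hj.symm
      obtain ⟨j, hj⟩ := exists_ne i
      refine ⟨i, 2 * s - 1 - a i, fun j hj => ?_, ?_⟩
      · have := hpair j hj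
        omega
      · have := hpair j hj
        omega
    · push Not at h
      obtain ⟨i, -, -⟩ := exists_pair_ne Q
      refine ⟨i, s - 1, fun j _ => ?_, ?_⟩
      · have := h j
        omega
      · have := h i
        omega
  have h1 := add_weightedDegree col a i
  have := hupper i M hM true
  have := hupper i M hM false
  omega

theorem even_sum_mul_weightedDegree (hsymm : ∀ i j, col i j = col j i) (b : Bool) :
    Even (∑ i, a i * weightedDegree col a i b) := by
  classical
  have h : ∑ i, a i * weightedDegree col a i b =
      ∑ p ∈ (Finset.univ : Finset (Q × Q)) with p.2 ≠ p.1 ∧ col p.1 p.2 = b, a p.1 * a p.2 := by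
    rw [Finset.sum_filter, Fintype.sum_prod_type]
    refine Finset.sum_congr rfl fun i _ => ?_
    unfold weightedDegree
    rw [Finset.mul_sum, Finset.sum_filter]
  rw [h, ← ZMod.natCast_eq_zero_iff_even, Nat.cast_sum]
  refine Finset.sum_involution (fun p _ => (p.2, p.1)) ?_ ?_ ?_ ?_
  · intro p _
    rw [mul_comm (a (p.2, p.1).1)]
    exact CharTwo.add_self_eq_zero _
  · intro p hp _ heq
    exact (Finset.mem_filter.1 hp).2.1 (congrArg Prod.fst heq)
  · intro p hp
    rw [Finset.mem_filter] at hp ⊢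
    exact ⟨Finset.mem_univ _, hp.2.1.symm, (hsymm _ _).trans hp.2.2⟩
  · intro p _
    rfl

theorem sum_ne_seven [Nontrivial Q] (hsymm : ∀ i j, col i j = col j i) (hpos : ∀ i, 1 ≤ a i)
    (hd : ∀ i b, weightedDegree col a i b ≤ 3) : ∑ j, a j ≠ 7 := by
  classical
  intro hn
  have hle : ∀ i, a i ≤ 3 := by
    intro i
    obtain ⟨j, hj⟩ := exists_ne i
    exact (le_weightedDegree hj.symm).trans (hd j _)
  have hmix : ∀ i, a i = 3 →
      weightedDegree col a i true = 0 ∨ weightedDegree col a i false = 0 := by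
    intro i hi
    by_contra hcon
    rw [not_or] at hcon
    obtain ⟨j, hj, -⟩ := Finset.exists_ne_zero_of_sum_ne_zero hcon.1
    obtain ⟨l, hl, -⟩ := Finset.exists_ne_zero_of_sum_ne_zero hcon.2
    rw [Finset.mem_filter] at hj hl
    have hjl : j ≠ l := by
      rintro rfl
      simp [hj.2.2] at hl
    cases h : col j l
    · have h1 := add_le_weightedDegree (a := a) (col := col) hl.2.1.symm hjl hj.2.1.symm
        (by rw [hsymm l i, hsymm l j, hl.2.2, h])
      have h2 := hd l (col l j)
      have := hpos j
      omega
    · have h1 := add_le_weightedDegree (a := a) (col := col) hj.2.1.symm hjl.symm hl.2.1.symm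
        (by rw [hsymm j i, hj.2.2, h])
      have h2 := hd j (col j l)
      have := hpos l
      omega
  have hpar : ∀ i, ((a i * weightedDegree col a i true : ℕ) : ZMod 2) = (a i : ℕ) := by
    intro i
    have h1 := add_weightedDegree col a i
    have h2 := hd i true
    have h3 := hd i false
    have h4 := hle i
    have h5 := hpos i
    have h6 := hmix i
    rw [ZMod.natCast_eq_natCast_iff]
    generalize weightedDegree col a i true = x at *
    generalize weightedDegree col a i false = y at *
    generalize a i = z at *
    unfold Nat.ModEq
    interval_cases z <;> omega
  have heven := even_sum_mul_weightedDegree (a := a) hsymm true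
  rw [← ZMod.natCast_eq_zero_iff_even, Nat.cast_sum, Finset.sum_congr rfl fun i _ => hpar i,
    ← Nat.cast_sum, hn, ZMod.natCast_eq_zero_iff_even] at heven
  exact absurd heven (by decide)

end Weighted

/-! ### The upper bound -/

/-- The weighted 2-coloring induced on the classes of a Gallai partition. -/
theorem exists_weighted_coloring {n k m : ℕ} (hn : 2 ≤ n) {c : Fin n → Fin n → Fin k}
    (hc : ∀ a b, c a b = c b a) (hR : ¬ RainbowTri Full c) (hM : ¬ ∃ i, MonoStar Full c m i) :
    ∃ (Q : Type) (_ : Fintype Q) (_ : Nontrivial Q) (col : Q → Q → Bool) (a : Q → ℕ),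
      (∀ i j, col i j = col j i) ∧ (∀ i, 1 ≤ a i) ∧
      (∀ i b, weightedDegree col a i b ≤ m - 1) ∧ ∑ j, a j = n := by
  classical
  have hG : ∀ a b d, a ≠ b → a ≠ d → b ≠ d →
      c a b = c a d ∨ c a b = c b d ∨ c a d = c b d := by
    intro a b d h1 h2 h3
    by_contra hcon
    push Not at hcon
    exact hR ⟨a, b, d, h1, h2, h3, hcon⟩
  have hdeg : ∀ v i, (Finset.univ.filter fun u => u ≠ v ∧ c v u = i).card ≤ m - 1 := by
    intro v i
    by_contra hcon
    obtain ⟨S, hS, hcard⟩ := Finset.exists_subset_card_eq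
      (show m ≤ (Finset.univ.filter fun u => u ≠ v ∧ c v u = i).card by omega)
    refine hM ⟨i, v, S, hcard, fun hv => ?_, fun u hu => ?_⟩
    · exact (Finset.mem_filter.1 (hS hv)).2.1 rfl
    · have := (Finset.mem_filter.1 (hS hu)).2
      exact ⟨this.1.symm, this.2⟩
  have : Nontrivial (Fin n) := Fin.nontrivial_iff_two_le.2 hn
  obtain ⟨R, B, X, hXS, hX, hY, hcut⟩ :=
    exists_two_colored_cut hc hG Finset.univ Finset.univ_nontrivial
  obtain ⟨r, ⟨p, -, q, -, hpq⟩, hRB, hhom⟩ := exists_setoid_of_cut hc hG hXS hX hY hcut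
  have hout : ∀ (i : Quotient r) (x : Fin n), i ≠ ⟦x⟧ →
      c i.out x = c i.out (⟦x⟧ : Quotient r).out := by
    intro i x hix
    refine hhom _ (Finset.mem_univ _) _ (Finset.mem_univ _) _ (Finset.mem_univ _)
      (r.symm (Quotient.mk_out x)) fun h => hix ?_
    rw [← Quotient.out_eq i]
    exact Quotient.sound h
  refine ⟨Quotient r, inferInstance, ⟨⟦p⟧, ⟦q⟧, fun h => hpq (Quotient.exact h)⟩,
    fun i j => decide (c i.out j.out = R),
    fun i => (Finset.univ.filter fun x => (⟦x⟧ : Quotient r) = i).card, ?_, ?_, ?_, ?_⟩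
  · intro i j
    simp only [hc i.out j.out]
  · intro i
    exact Finset.card_pos.2 ⟨i.out, by simp⟩
  · intro i b
    unfold weightedDegree
    refine le_trans ?_ (hdeg i.out (if b then R else B))
    rw [Finset.sum_card_fiberwise_eq_card_filter]
    refine Finset.card_le_card fun x hx => ?_
    simp only [Finset.mem_filter, Finset.mem_univ, true_and] at hx ⊢
    obtain ⟨hxi, hxb⟩ := hx
    have hxi' : ¬ r i.out x := fun h =>
      hxi (by rw [← Quotient.out_eq i]; exact (Quotient.sound h).symm)
    refine ⟨fun h => hxi (by rw [h, Quotient.out_eq]), ?_⟩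
    rw [← hout i x (Ne.symm hxi)] at hxb
    cases b
    · exact (hRB _ (Finset.mem_univ _) _ (Finset.mem_univ _) hxi').resolve_left (by simpa using hxb)
    · simpa using hxb
  · rw [← Finset.card_eq_sum_card_fiberwise (f := fun x => (⟦x⟧ : Quotient r)) (by simp)]
    simp

theorem rainbowTri_or_monoStar {k m : ℕ} (hm : 3 ≤ m)
    (c : Fin (if Even m then (5 * m - 6) / 2 else (5 * m - 3) / 2) →
      Fin (if Even m then (5 * m - 6) / 2 else (5 * m - 3) / 2) → Fin k)
    (hc : ∀ a b, c a b = c b a) : RainbowTri Full c ∨ ∃ i, MonoStar Full c m i := by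
  by_contra hcon
  rw [not_or] at hcon
  obtain ⟨Q, _, _, col, a, hsymm, hpos, hd, hsum⟩ := exists_weighted_coloring
    (by split_ifs <;> omega) hc hcon.1 hcon.2
  clear hcon hc
  split_ifs at hsum with h
  · obtain ⟨s, rfl⟩ := h
    by_cases hs : s = 2
    · subst hs
      exact sum_ne_seven hsymm hpos hd hsum
    · refine sum_ne_of_three_le (s := s) hsymm (by omega) (fun i b => ?_) (hsum.trans (by omega))
      have := hd i b
      omega
  · obtain ⟨t, rfl⟩ := Nat.not_even_iff_odd.1 h
    refine sum_ne_five_mul_add_one (t := t) hsymm (fun i b => ?_) (hsum.trans (by omega))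
    have := hd i b
    omega

theorem stmt12 (k m : ℕ) (hk : 3 ≤ k) (hm : 3 ≤ m) :
    IsLeast {n | ∀ c : Fin n → Fin n → Fin k, (∀ a b, c a b = c b a) →
      RainbowTri Full c ∨ ∃ i, MonoStar Full c m i}
      (if Even m then (5 * m - 6) / 2 else (5 * m - 3) / 2) := by
  refine ⟨fun c hc => rainbowTri_or_monoStar hm c hc, fun n hn => ?_⟩
  by_contra hlt
  obtain ⟨c, hc, hR, hM⟩ := exists_coloring_of_lt hk hm (not_le.1 hlt)
  rcases hn c hc with h | h
  · exact hR h
  · exact hM h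
end

section
/- For every k ≥ 3 and even m ≥ 12, the star-critical Gallai-Ramsey number gr_k^*(K_3 : K_{1,m}) equals 2m - 2. -/
/-- Connectivity inside `s` through edges whose colour is neither `r` nor `b`. -/
def Linked {V C : Type} (c : V → V → C) (s : Finset V) (r b : C) : V → V → Prop :=
  Relation.ReflTransGen fun x y => x ∈ s ∧ y ∈ s ∧ x ≠ y ∧ c x y ≠ r ∧ c x y ≠ b

/-- No triangle of the complete graph on `V` is rainbow. -/
def IsGallai {V C : Type} (c : V → V → C) : Prop :=
  ∀ x y z, x ≠ y → x ≠ z → y ≠ z → c x y = c x z ∨ c x y = c y z ∨ c x z = c y z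

section Linked

variable {V C : Type} {c : V → V → C} {s : Finset V} {r b : C} {x x' y : V}

theorem Linked.symm (hc : ∀ x y, c x y = c y x) (h : Linked c s r b x y) :
    Linked c s r b y x := by
  induction h with
  | refl => exact .refl
  | @tail u w _ hw ih =>
    obtain ⟨hu, hw, huw, h1, h2⟩ := hw
    exact .head ⟨hw, hu, huw.symm, hc u w ▸ h1, hc u w ▸ h2⟩ ih

theorem color_of_not_linked (hx : x ∈ s) (hy : y ∈ s) (h : ¬ Linked c s r b x y) :
    c x y = r ∨ c x y = b := by
  by_contra! hne
  refine h (Relation.ReflTransGen.single ⟨hx, hy, ?_, hne.1, hne.2⟩)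
  rintro rfl
  exact h Relation.ReflTransGen.refl

theorem color_eq_of_linked (hG : IsGallai c) (hx : x ∈ s)
    (hy : y ∈ s) (hxx' : Linked c s r b x x') (h : ¬ Linked c s r b x y) :
    c x y = c x' y := by
  have key : c x y = c x' y ∧ x' ∈ s := by
    induction hxx' with
    | refl => exact ⟨rfl, hx⟩
    | @tail u w hu hw ih =>
      obtain ⟨hus, hws, huw, hr, hb⟩ := hw
      have hu' : ¬ Linked c s r b u y := fun h' => h (hu.trans h')
      have hw' : ¬ Linked c s r b w y := fun h' =>
        h ((hu.tail ⟨hus, hws, huw, hr, hb⟩).trans h')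
      have h1 := color_of_not_linked hus hy hu'
      have h2 := color_of_not_linked hws hy hw'
      have huy : u ≠ y := by rintro rfl; exact hu' Relation.ReflTransGen.refl
      have hwy : w ≠ y := by rintro rfl; exact hw' Relation.ReflTransGen.refl
      refine ⟨?_, hws⟩
      rw [ih.1]
      have := hG u w y huw huy hwy
      grind
  exact key.1

theorem not_linked_of_cut (S : Set V) (hx : x ∈ S) (hy : y ∉ S)
    (hS : ∀ u ∈ s, ∀ w ∈ s, u ∈ S → w ∉ S → c u w = r ∨ c u w = b) :
    ¬ Linked c s r b x y := by
  intro h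
  refine hy ?_
  induction h with
  | refl => exact hx
  | @tail u w _ hw ih =>
    by_contra hwS
    have hu : u ∈ S := by
      by_contra hu
      exact hu (ih hu)
    have := hS u hw.1 w hw.2.1 hu hwS
    grind

/-- The Gallai partition theorem: some two colours separate a colouring without rainbow triangles. -/
theorem exists_not_linked [DecidableEq V] (hc : ∀ x y, c x y = c y x) (hG : IsGallai c)
    (s : Finset V) (hs : 2 ≤ s.card) :
    ∃ r b, ∃ x ∈ s, ∃ y ∈ s, ¬ Linked c s r b x y := by
  induction s using Finset.induction_on with
  | empty => simp at hs
  | insert v s hv ih =>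
    have isolated : ∀ r b, (∀ y ∈ s, c v y = r ∨ c v y = b) →
        ∃ r b, ∃ x ∈ insert v s, ∃ y ∈ insert v s, ¬ Linked c (insert v s) r b x y := by
      intro r b h
      have hne : s.Nonempty := by
        rw [Finset.card_insert_of_notMem hv] at hs
        exact Finset.card_pos.1 (by omega)
      obtain ⟨y, hy⟩ := hne
      refine ⟨r, b, v, by simp, y, by simp [hy], not_linked_of_cut {v} rfl ?_ ?_⟩
      · rintro rfl; exact hv hy
      · rintro u _ w hw rfl hwv
        exact h w (by simp at hw hwv; tauto)
    by_cases h2 : 2 ≤ s.card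
    swap
    · have h1 : s.card = 1 := by
        rw [Finset.card_insert_of_notMem hv] at hs; omega
      obtain ⟨y, rfl⟩ := Finset.card_eq_one.1 h1
      exact isolated (c v y) (c v y) (by simp)
    obtain ⟨r, b, x₁, hx₁, x₂, hx₂, h12⟩ := ih h2
    by_cases hcase : ∃ x ∈ s, ∀ z ∈ s, Linked c s r b x z → c v z = r ∨ c v z = b
    · obtain ⟨x, hx, hxz⟩ := hcase
      refine ⟨r, b, x, by simp [hx], v, by simp,
        not_linked_of_cut {z | z ∈ s ∧ Linked c s r b x z} ⟨hx, .refl⟩ (by simp [hv]) ?_⟩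
      rintro u _ w hw ⟨hus, hu⟩ hwS
      rcases Finset.mem_insert.1 hw with rfl | hws
      · rw [hc]; exact hxz u hus hu
      · refine color_of_not_linked hus hws fun h => hwS ⟨hws, hu.trans h⟩
    push Not at hcase
    obtain ⟨y₁, hy₁, hl₁, hr₁, hb₁⟩ := hcase x₁ hx₁
    have hg : ∀ y ∈ s, ∃ z ∈ s, Linked c s r b y z ∧ c v z = c v y₁ := by
      have aux : ∀ y ∈ s, ¬ Linked c s r b x₁ y →
          ∃ z ∈ s, Linked c s r b y z ∧ c v z = c v y₁ := by
        intro y hy hn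
        obtain ⟨z, hz, hl, hr, hb⟩ := hcase y hy
        refine ⟨z, hz, hl, ?_⟩
        have hnz : ¬ Linked c s r b y₁ z := fun h =>
          hn ((hl₁.trans h).trans (hl.symm hc))
        have h3 := color_of_not_linked hy₁ hz hnz
        have := hG v y₁ z (by grind) (by grind)
          (by rintro rfl; exact hnz .refl)
        grind
      intro y hy
      by_cases hn : Linked c s r b x₁ y
      · exact ⟨y₁, hy₁, (hn.symm hc).trans hl₁, rfl⟩
      · exact aux y hy hn
    have hother : ∀ y ∈ s, ∃ z ∈ s, ¬ Linked c s r b y z := by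
      intro y hy
      by_contra! h
      exact h12 (((h x₁ hx₁).symm hc).trans (h x₂ hx₂))
    have hvy : ∀ y ∈ s, ∀ z ∈ s, ¬ Linked c s r b y z → c v y ≠ c v y₁ → c y z = c v y := by
      intro y hy z hz hn hne
      obtain ⟨w, hw, hzw, hwg⟩ := hg z hz
      have hnw : ¬ Linked c s r b y w := fun h => hn (h.trans (hzw.symm hc))
      have e := color_eq_of_linked hG hz hy hzw (fun h => hn (h.symm hc))
      have h3 := color_of_not_linked hy hw hnw
      have h4 := hG v y w (by grind) (by grind) (by rintro rfl; exact hnw .refl)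
      rw [hc y z, e, hc w y]
      grind
    have hrb : ∀ y ∈ s, c v y ≠ c v y₁ → c v y = r ∨ c v y = b := by
      intro y hy hne
      obtain ⟨z, hz, hn⟩ := hother y hy
      rw [← hvy y hy z hz hn hne]
      exact color_of_not_linked hy hz hn
    have huniq : ∀ y ∈ s, ∀ z ∈ s, c v y ≠ c v y₁ → c v z ≠ c v y₁ → c v y = c v z := by
      intro y hy z hz hy' hz'
      by_cases hn : Linked c s r b y z
      · obtain ⟨w, hw, hnw⟩ := hother y hy
        rw [← hvy y hy w hw hnw hy',
          ← hvy z hz w hw (fun h => hnw (hn.trans h)) hz']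
        exact color_eq_of_linked hG hy hw hn hnw
      · rw [← hvy y hy z hz hn hy', ← hvy z hz y hy (fun h => hn (h.symm hc)) hz', hc]
    by_cases hall : ∀ y ∈ s, c v y = c v y₁
    · exact isolated _ (c v y₁) fun y hy => Or.inl (hall y hy)
    · push Not at hall
      obtain ⟨z, hz, hzg⟩ := hall
      refine isolated (c v y₁) (c v z) fun y hy => ?_
      by_cases h : c v y = c v y₁
      · exact Or.inl h
      · exact Or.inr (huniq y hy z hz h hzg)

end Linked

section Weights

open Finset

/-- The total weight of the parts joined to `i` in the colour `β`. -/
def weightSum {q : ℕ} (w : Fin q → ℕ) (col : Fin q → Fin q → Bool) (i : Fin q) (β : Bool) : ℕ :=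
  ∑ j with j ≠ i ∧ col i j = β, w j

variable {q t : ℕ} {w : Fin q → ℕ} {col : Fin q → Fin q → Bool}

theorem not_card_le_four (hq : 2 ≤ q) (hq4 : q ≤ 4) (ht : 6 ≤ t)
    (hcol : ∀ i j, col i j = col j i) (hw : ∑ i, w i + 4 = 5 * t)
    (hdeg : ∀ i β, weightSum w col i β < 2 * t) : False := by
  simp only [weightSum, Finset.sum_filter] at hdeg
  interval_cases q
  · have h0 := hdeg 0 (col 0 1)
    have h1 := hdeg 1 (col 0 1)
    have e := hcol 1 0
    simp [Fin.sum_univ_succ, e] at h0 h1 hw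
    omega
  · have hT := fun i => hdeg i true
    have hF := fun i => hdeg i false
    simp [Fin.forall_fin_succ, Fin.sum_univ_succ, hcol 1 0, hcol 2 0, hcol 2 1] at hT hF hw
    clear hdeg hcol
    generalize col 0 1 = c01 at hT hF
    generalize col 0 2 = c02 at hT hF
    generalize col 1 2 = c12 at hT hF
    cases c01 <;> cases c02 <;> cases c12 <;>
      simp at hT hF <;> omega
  · have hT := fun i => hdeg i true
    have hF := fun i => hdeg i false
    simp [Fin.forall_fin_succ, Fin.sum_univ_succ, hcol 1 0, hcol 2 0, hcol 3 0, hcol 2 1,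
      hcol 3 1, hcol 3 2] at hT hF hw
    clear hdeg hcol
    generalize col 0 1 = c01 at hT hF
    generalize col 0 2 = c02 at hT hF
    generalize col 0 3 = c03 at hT hF
    generalize col 1 2 = c12 at hT hF
    generalize col 1 3 = c13 at hT hF
    generalize col 2 3 = c23 at hT hF
    cases c01 <;> cases c02 <;> cases c03 <;> cases c12 <;> cases c13 <;> cases c23 <;>
      simp at hT hF <;> omega

theorem sum_eq_add_weightSum (i : Fin q) :
    ∑ j, w j = w i + (weightSum w col i true + weightSum w col i false) := by
  have h1 : ∑ j, w j = w i + ∑ j with j ≠ i, w j := by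
    rw [Finset.filter_ne', Finset.add_sum_erase _ _ (mem_univ i)]
  have h2 := Finset.sum_filter_add_sum_filter_not (univ.filter fun j => j ≠ i)
    (fun j => col i j = true) w
  simp only [Finset.filter_filter, Bool.not_eq_true] at h2
  rw [h1, ← h2]
  rfl

/-- The only way to meet the degree bounds is a blown-up pentagon with part sizes
`t, t - 1, t - 1, t - 1, t - 1`. -/
theorem exists_large_part (hq : 2 ≤ q) (ht : 6 ≤ t)
    (hcol : ∀ i j, col i j = col j i) (hw : ∑ i, w i + 4 = 5 * t)
    (hdeg : ∀ i β, weightSum w col i β < 2 * t) :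
    ∃ i, w i = t ∧ (∀ j, j ≠ i → w j + 1 = t) ∧
      (∀ β, weightSum w col i β + 2 = 2 * t) ∧
      ∀ j, j ≠ i → weightSum w col j (col j i) + 1 = 2 * t := by
  have hlow : ∀ i, t - 2 ≤ w i := fun i => by
    have := sum_eq_add_weightSum (w := w) (col := col) i
    have := hdeg i true
    have := hdeg i false
    omega
  have hle2 : ∀ i β, (univ.filter fun j => j ≠ i ∧ col i j = β).card ≤ 2 := by
    intro i β
    have h1 := Finset.card_nsmul_le_sum (univ.filter fun j => j ≠ i ∧ col i j = β) w (t - 2)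
      fun j _ => hlow j
    have h2 : (univ.filter fun j => j ≠ i ∧ col i j = β).sum w < 2 * t := hdeg i β
    by_contra! h3
    have h4 := Nat.mul_le_mul_right (t - 2) h3
    rw [smul_eq_mul] at h1
    omega
  have hcard : ∀ i, (univ.filter fun j => j ≠ i ∧ col i j = true).card +
      (univ.filter fun j => j ≠ i ∧ col i j = false).card + 1 = q := by
    intro i
    have := sum_eq_add_weightSum (w := fun _ => 1) (col := col) i
    simp only [weightSum, sum_const, smul_eq_mul, mul_one, card_univ, Fintype.card_fin] at this
    omega
  have hq5 : q = 5 := by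
    have h0 := hcard ⟨0, by omega⟩
    have h1 := hle2 ⟨0, by omega⟩ true
    have h2 := hle2 ⟨0, by omega⟩ false
    by_contra hne
    exact not_card_le_four hq (by omega) ht hcol hw hdeg
  subst hq5
  have heq2 : ∀ i β, (univ.filter fun j => j ≠ i ∧ col i j = β).card = 2 := by
    intro i β
    have h0 := hcard i
    have h1 := hle2 i true
    have h2 := hle2 i false
    cases β <;> omega
  have hpair : ∀ i j, i ≠ j → w i + w j < 2 * t := by
    intro i j hij
    obtain ⟨l, hl⟩ : ((univ.filter fun l => l ≠ i ∧ col i l = !col i j) ∩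
        (univ.filter fun l => l ≠ j ∧ col j l = !col i j)).Nonempty := by
      rw [← Finset.card_pos]
      have h1 := Finset.card_union_add_card_inter
        (univ.filter fun l => l ≠ i ∧ col i l = !col i j)
        (univ.filter fun l => l ≠ j ∧ col j l = !col i j)
      rw [heq2, heq2] at h1
      have h2 : ((univ.filter fun l => l ≠ i ∧ col i l = !col i j) ∪
        (univ.filter fun l => l ≠ j ∧ col j l = !col i j)) ⊆ univ \ {i, j} := by
        intro l hl
        have := hcol i j
        simp only [mem_union, mem_filter, mem_univ, true_and, mem_sdiff, mem_insert,
          mem_singleton] at hl ⊢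
        rintro (rfl | rfl)
        · rcases hl with hl | hl
          · exact hl.1 rfl
          · simp [this] at hl
        · rcases hl with hl | hl
          · simp at hl
          · exact hl.1 rfl
      have h3 := Finset.card_le_card h2
      rw [Finset.card_sdiff_of_subset (subset_univ _), Finset.card_pair hij] at h3
      rw [card_univ, Fintype.card_fin] at h3
      omega
    simp only [mem_inter, mem_filter, mem_univ, true_and] at hl
    have h1 := hdeg l (!col i j)
    have h2 : ∑ x ∈ {i, j}, w x ≤ weightSum w col l (!col i j) := by
      refine Finset.sum_le_sum_of_subset fun x hx => ?_
      simp only [mem_insert, mem_singleton] at hx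
      rcases hx with rfl | rfl
      · simp [hl.1.1.symm, ← hl.1.2, hcol l x]
      · simp [hl.2.1.symm, ← hl.2.2, hcol l x]
    rw [Finset.sum_pair hij] at h2
    omega
  obtain ⟨i, hi, hj⟩ : ∃ i, w i = t ∧ ∀ j, j ≠ i → w j + 1 = t := by
    have h01 := hpair 0 1 (by decide)
    have h02 := hpair 0 2 (by decide)
    have h03 := hpair 0 3 (by decide)
    have h04 := hpair 0 4 (by decide)
    have h12 := hpair 1 2 (by decide)
    have h13 := hpair 1 3 (by decide)
    have h14 := hpair 1 4 (by decide)
    have h23 := hpair 2 3 (by decide)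
    have h24 := hpair 2 4 (by decide)
    have h34 := hpair 3 4 (by decide)
    rw [Fin.sum_univ_five] at hw
    have : ∃ i, t ≤ w i := by
      by_contra! h
      have := h 0
      have := h 1
      have := h 2
      have := h 3
      have := h 4
      omega
    obtain ⟨i, hi⟩ := this
    refine ⟨i, ?_, fun j hj => ?_⟩
    · fin_cases i <;> simp at hi ⊢ <;> omega
    · fin_cases i <;> fin_cases j <;> simp at hi hj ⊢ <;> omega
  refine ⟨i, hi, hj, fun β => ?_, fun j hji => ?_⟩
  · have h1 : weightSum w col i β = ∑ j with j ≠ i ∧ col i j = β, (t - 1) :=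
      Finset.sum_congr rfl fun j hj' => by
        have := hj j (mem_filter.1 hj').2.1
        omega
    rw [h1, sum_const, heq2, smul_eq_mul]
    omega
  · have hmem : i ∈ univ.filter fun l => l ≠ j ∧ col j l = col j i := by simp [hji.symm]
    have h1 := Finset.add_sum_erase _ w hmem
    have h2 : ∑ l ∈ (univ.filter fun l => l ≠ j ∧ col j l = col j i).erase i, w l =
        ∑ l ∈ (univ.filter fun l => l ≠ j ∧ col j l = col j i).erase i, (t - 1) :=
      Finset.sum_congr rfl fun l hl => by
        have := hj l (mem_erase.1 hl).1
        omega
    rw [h2, sum_const, card_erase_of_mem hmem, heq2, smul_eq_mul] at h1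
    unfold weightSum
    omega

end Weights

section Structure

open Finset

variable {V C : Type} [Fintype V] [DecidableEq V] [DecidableEq C] {c : V → V → C} {t : ℕ}

theorem exists_pentagon_blowup (hc : ∀ x y, c x y = c y x) (hG : IsGallai c) (ht : 6 ≤ t)
    (hV : Fintype.card V + 4 = 5 * t)
    (hdeg : ∀ x g, (univ.filter fun y => y ≠ x ∧ c x y = g).card < 2 * t) :
    ∃ (r b : C) (q : ℕ) (π : V → Fin q) (i : Fin q), r ≠ b ∧
      (∀ x y, π x ≠ π y → c x y = r ∨ c x y = b) ∧
      (∀ x x' y, π x = π x' → π x ≠ π y → c x y = c x' y) ∧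
      (univ.filter fun y => π y = i).card = t ∧
      (∀ j, j ≠ i → (univ.filter fun y => π y = j).card + 1 = t) ∧
      (∀ x, π x = i → ∀ g, g = r ∨ g = b →
        (univ.filter fun y => π y ≠ i ∧ c x y = g).card + 2 = 2 * t) ∧
      ∀ x y, π x = i → π y ≠ i →
        2 * t ≤ (univ.filter fun z => z ≠ y ∧ c y z = c y x).card + 1 := by
  classical
  obtain ⟨r, b, x₁, -, x₂, -, h12⟩ := exists_not_linked hc hG (univ : Finset V)
    (by rw [card_univ]; omega)
  let S : Setoid V := ⟨Linked c univ r b, fun _ => .refl, fun h => h.symm hc, fun h h' => h.trans h'⟩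
  let e := Fintype.equivFin (Quotient S)
  let π : V → Fin (Fintype.card (Quotient S)) := fun x => e ⟦x⟧
  have hπ : ∀ x y, π x = π y ↔ Linked c univ r b x y := fun x y =>
    e.apply_eq_iff_eq.trans Quotient.eq
  have hπs : ∀ j, ∃ x, π x = j := fun j => by
    obtain ⟨x, hx⟩ := Quotient.exists_rep (e.symm j)
    exact ⟨x, by simp [π, hx]⟩
  have hq : 2 ≤ Fintype.card (Quotient S) := by
    have : π x₁ ≠ π x₂ := fun h => h12 ((hπ _ _).1 h)
    by_contra! h
    exact this (Fin.ext (by omega))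
  clear_value π e
  clear e
  generalize Fintype.card (Quotient S) = q at π hπ hπs hq
  have hrb : ∀ x y, π x ≠ π y → c x y = r ∨ c x y = b := fun x y h =>
    color_of_not_linked (mem_univ _) (mem_univ _) fun h' => h ((hπ _ _).2 h')
  have hhom : ∀ x x' y, π x = π x' → π x ≠ π y → c x y = c x' y := fun x x' y h h' =>
    color_eq_of_linked hG (mem_univ _) (mem_univ _) ((hπ _ _).1 h)
      fun hl => h' ((hπ _ _).2 hl)
  choose σ hσ using hπs
  let w : Fin q → ℕ := fun j => (univ.filter fun y => π y = j).card
  let col : Fin q → Fin q → Bool := fun i j => decide (c (σ i) (σ j) = r)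
  have hcol : ∀ i j, col i j = col j i := fun i j => by simp [col, hc (σ i)]
  have hcolπ : ∀ x y, π x ≠ π y → (col (π x) (π y) = decide (c x y = r)) := fun x y h => by
    have h1 := hhom (σ (π x)) x (σ (π y)) (hσ _) (by rwa [hσ, hσ])
    have h2 := hhom (σ (π y)) y x (hσ _) (by rw [hσ]; exact h.symm)
    simp only [col]
    rw [h1, hc x, h2, hc x]
  have hsum : ∀ x β, weightSum w col (π x) β =
      (univ.filter fun y => π y ≠ π x ∧ decide (c x y = r) = β).card := by
    intro x β
    have h1 : (univ.filter fun y => π y ≠ π x ∧ decide (c x y = r) = β) =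
        univ.filter fun y => π y ∈ univ.filter fun j => j ≠ π x ∧ col (π x) j = β := by
      ext y
      simp only [mem_filter, mem_univ, true_and]
      refine and_congr_right fun h => ?_
      rw [hcolπ x y h.symm]
    rw [h1, ← Finset.sum_card_fiberwise_eq_card_filter]
    rfl
  have htot : ∑ j, w j + 4 = 5 * t := by
    rw [← hV, ← card_univ, Finset.card_eq_sum_card_fiberwise (f := π) (t := univ) (by simp)]
  have hdeg' : ∀ i β, weightSum w col i β < 2 * t := by
    intro i β
    rw [← hσ i, hsum]
    refine lt_of_le_of_lt (card_le_card ?_) (hdeg (σ i) (if β then r else b))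
    intro y hy
    simp only [mem_filter, mem_univ, true_and] at hy ⊢
    refine ⟨fun h => hy.1 (h ▸ rfl), ?_⟩
    have := hrb (σ i) y hy.1.symm
    cases β <;> simp at hy ⊢ <;> tauto
  obtain ⟨i, hi, hj, hi', hj'⟩ := exists_large_part hq ht hcol htot hdeg'
  have hne : r ≠ b := by
    rintro rfl
    have h1 := hi' false
    rw [← hσ i, hsum] at h1
    have h2 : (univ.filter fun y => π y ≠ π (σ i) ∧ decide (c (σ i) y = r) = false) = ∅ := by
      ext y
      simp
      intro h
      have := hrb (σ i) y fun h' => h h'.symm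
      tauto
    rw [h2] at h1
    simp at h1
    omega
  refine ⟨r, b, q, π, i, hne, hrb, hhom, hi, hj, ?_, ?_⟩
  · rintro x rfl g hg
    rw [← hi' (decide (g = r)), hsum]
    congr 2
    ext y
    simp only [mem_filter, mem_univ, true_and]
    refine and_congr_right fun h => ?_
    have := hrb x y h.symm
    rcases hg with rfl | rfl <;> rcases this with h | h <;> simp [h, hne, hne.symm]
  · rintro x y rfl hy
    rw [← hj' (π y) hy, hsum]
    refine Nat.add_le_add_right (card_le_card fun z hz => ?_) 1
    simp only [mem_filter, mem_univ, true_and] at hz ⊢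
    refine ⟨fun h => hz.1 (h ▸ rfl), ?_⟩
    rw [hcolπ y x hy] at hz
    have h1 := hrb y x hy
    have h2 := hrb y z hz.1.symm
    rcases h1 with h1 | h1 <;> rcases h2 with h2 | h2 <;> simp_all

theorem no_extension (hc : ∀ x y, c x y = c y x) (hG : IsGallai c) (ht : 6 ≤ t)
    (hV : Fintype.card V + 4 = 5 * t)
    (hdeg : ∀ x g, (univ.filter fun y => y ≠ x ∧ c x y = g).card < 2 * t)
    (A : Finset V) (hA : A.card + 2 = 4 * t) (f : V → C)
    (hf : ∀ g, (A.filter fun y => f y = g).card < 2 * t)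
    (hAdeg : ∀ x ∈ A, (univ.filter fun y => y ≠ x ∧ c x y = f x).card + 1 < 2 * t)
    (htri : ∀ x ∈ A, ∀ y ∈ A, x ≠ y → f x = f y ∨ f x = c x y ∨ f y = c x y) : False := by
  obtain ⟨r, b, q, π, i, hne, hrb, hhom, hi, hj, hout, hsat⟩ :=
    exists_pentagon_blowup hc hG ht hV hdeg
  have hnsat : ∀ x y, y ∈ A → π x = i → π y ≠ i → f y ≠ c y x := by
    intro x y hy hx hyi h
    have h1 := hAdeg y hy
    have h2 := hsat x y hx hyi
    rw [h] at h1
    omega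
  have hhit : ∀ j, ∃ z ∈ A, π z = j := by
    intro j
    by_contra! h
    have h1 : (univ.filter fun y => π y = j) ⊆ Aᶜ := by
      intro y hy
      simp only [mem_filter, mem_univ, true_and, mem_compl] at hy ⊢
      exact fun hyA => h y hyA hy
    have h2 := card_le_card h1
    rw [card_compl] at h2
    by_cases hji : j = i
    · subst hji; omega
    · have := hj j hji; omega
  have hlarge : ∀ y ∈ A, π y = i → f y = r ∨ f y = b := by
    intro y hy hyi
    by_contra! hn
    have h1 : A.filter (fun z => ¬ π z = i) ⊆ A.filter fun z => f z = f y := by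
      intro z hz
      simp only [mem_filter] at hz ⊢
      refine ⟨hz.1, ?_⟩
      have hyz : π y ≠ π z := fun h => hz.2 (h ▸ hyi)
      have h2 := hnsat y z hz.1 hyi hz.2
      have h3 := hrb y z hyz
      have h4 := htri y hy z hz.1 fun h => hyz (h ▸ rfl)
      rw [hc z y] at h2
      grind
    have h2 := card_le_card h1
    have h3 := Finset.card_filter_add_card_filter_not (s := A) fun z => π z = i
    have h4 := card_le_card (Finset.filter_subset_filter (fun z => π z = i) (subset_univ A))
    have h5 := hf (f y)
    omega
  have hall : ∀ y ∈ A, f y = r ∨ f y = b := by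
    intro y hy
    by_cases hyi : π y = i
    · exact hlarge y hy hyi
    by_contra! hn
    obtain ⟨x, hx, hxi⟩ := hhit i
    have hyx : π y ≠ π x := fun h => hyi (h.trans hxi)
    obtain ⟨δ, hδ, hδy, hcases⟩ : ∃ δ, (δ = r ∨ δ = b) ∧ δ ≠ c y x ∧
        ∀ e, e = r ∨ e = b → e = δ ∨ e = c y x := by
      rcases hrb y x hyx with h | h
      · exact ⟨b, .inr rfl, by rw [h]; exact hne.symm, fun e he => by rw [h]; tauto⟩
      · exact ⟨r, .inl rfl, by rw [h]; exact hne, fun e he => by rw [h]; tauto⟩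
    obtain ⟨w₀, hw₀i, hw₀x, hw₀y⟩ : ∃ w, π w ≠ i ∧ c x w = δ ∧ c y w = δ := by
      by_contra! h
      have h1 : (univ.filter fun z => π z = i) ∪ (univ.filter fun z => π z ≠ i ∧ c x z = δ) ⊆
          univ.filter fun z => z ≠ y ∧ c y z = c y x := by
        intro z hz
        simp only [mem_union, mem_filter, mem_univ, true_and] at hz ⊢
        rcases hz with hz | ⟨hz, hz'⟩
        · refine ⟨fun h => hyi (h ▸ hz), ?_⟩
          rw [hc y z, hc y x]
          exact hhom z x y (hz.trans hxi.symm) (by rw [hz]; exact Ne.symm hyi)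
        · have hzy : π z ≠ π y := by
            intro h'
            have := hhom z y x h' (by rw [hxi]; exact hz)
            rw [hc z x] at this
            exact hδy (hz'.symm.trans this)
          refine ⟨fun h' => hzy (h' ▸ rfl), ?_⟩
          have h3 := hcases _ (hrb y z hzy.symm)
          have h4 := h z hz hz'
          tauto
      have h2 := card_le_card h1
      rw [card_union_of_disjoint (by
        rw [Finset.disjoint_left]
        intro z hz hz'
        simp only [mem_filter, mem_univ, true_and] at hz hz'
        exact hz'.1 hz)] at h2
      have h3 := hdeg y (c y x)
      have h4 := hout x hxi δ hδ
      omega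
    obtain ⟨w, hw, hww₀⟩ := hhit (π w₀)
    have hwi : π w ≠ i := by rw [hww₀]; exact hw₀i
    have hwx : c w x = δ := by
      rw [hhom w w₀ x hww₀ (by rw [hxi]; exact hwi), hc, hw₀x]
    have hyw₀ : π w₀ ≠ π y := by
      intro h'
      have := hhom w₀ y x h' (by rw [hxi]; exact hw₀i)
      rw [hc w₀ x, hw₀x] at this
      exact hδy this
    have hwy : c w y = δ := by
      rw [hhom w w₀ y hww₀ (by rw [hww₀]; exact hyw₀), hc, hw₀y]
    have h1 := htri w hw y hy (by rintro rfl; exact hyw₀ hww₀.symm)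
    have h2 := htri y hy x hx (by rintro rfl; exact hyi hxi)
    have h3 := htri w hw x hx (by rintro rfl; exact hwi hxi)
    have h4 := hnsat x w hw hxi hwi
    have h5 := hrb y x hyx
    have h6 := hlarge x hx hxi
    grind
  have hsplit : A.card ≤ (A.filter fun y => f y = r).card + (A.filter fun y => f y = b).card := by
    refine (card_le_card fun y hy => ?_).trans (card_union_le _ _)
    have := hall y hy
    simp only [mem_union, mem_filter]
    tauto
  have hfr := hf r
  have hfb := hf b
  obtain ⟨x₀, hx₀, hx₀i⟩ := hhit i
  have hex : ∀ g g', (g = r ∨ g = b) → (g' = r ∨ g' = b) → g ≠ g' →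
      ∃ x ∈ A, π x = i ∧ f x = g := by
    intro g g' hg hg' hgg
    by_contra! h
    have h1 : (A.filter fun y => f y = g) ⊆ univ.filter fun y => π y ≠ i ∧ c x₀ y = g' := by
      intro y hy
      simp only [mem_filter, mem_univ, true_and] at hy ⊢
      have hyi : π y ≠ i := fun h' => h y hy.1 h' hy.2
      have h2 := hnsat x₀ y hy.1 hx₀i hyi
      have h3 := hrb x₀ y (by rw [hx₀i]; exact hyi.symm)
      rw [hc y x₀] at h2
      grind
    have h2 := card_le_card h1
    have h3 := hout x₀ hx₀i g' hg'
    have : 2 * t ≤ (A.filter fun y => f y = g).card + 1 := by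
      rcases hg with rfl | rfl <;> omega
    omega
  have hbad : ∀ x ∈ A, ∀ z, x ≠ z → π x = i → π z = i → (f x = r ∨ f x = b) → c x z ≠ f x := by
    intro x hx z hxz hxi hzi hfx h
    have h1 : insert z (univ.filter fun y => π y ≠ i ∧ c x y = f x) ⊆
        univ.filter fun y => y ≠ x ∧ c x y = f x := by
      intro y hy
      simp only [mem_insert, mem_filter, mem_univ, true_and] at hy ⊢
      rcases hy with rfl | ⟨hy, hy'⟩
      · exact ⟨hxz.symm, h⟩
      · exact ⟨fun h' => hy (h' ▸ hxi), hy'⟩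
    have h2 := card_le_card h1
    rw [card_insert_of_notMem (by simp [hzi])] at h2
    have h3 := hout x hxi (f x) hfx
    have h4 := hAdeg x hx
    omega
  obtain ⟨x, hx, hxi, hfx⟩ := hex r b (.inl rfl) (.inr rfl) hne
  obtain ⟨z, hz, hzi, hfz⟩ := hex b r (.inr rfl) (.inl rfl) hne.symm
  have hxz : x ≠ z := by rintro rfl; exact hne (hfx.symm.trans hfz)
  have h1 := hbad x hx z hxz hxi hzi (.inl hfx)
  have h2 := hbad z hz x hxz.symm hzi hxi (.inr hfz)
  have h3 := htri x hx z hz hxz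
  rw [hc z x] at h2
  grind

end Structure

section Extremal

open Finset

/-- Colours between the parts of a pentagon blow-up; part `5` is the added vertex. -/
def partColor (a b : Fin 6) : Fin 3 :=
  if a = b then 2
  else if (a, b) ∈ ({(0, 1), (1, 2), (2, 3), (3, 4), (0, 4), (0, 5), (2, 5), (3, 5),
    (1, 0), (2, 1), (3, 2), (4, 3), (4, 0), (5, 0), (5, 2), (5, 3)} : Finset (Fin 6 × Fin 6))
  then 0 else 1

/-- The part containing the `i`-th vertex: sizes `t, t - 1, t - 1, t - 1, t - 1` and `1`. -/
def partOf (t i : ℕ) : Fin 6 :=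
  if i < t then 0 else if i < 2 * t - 1 then 1 else if i < 3 * t - 2 then 2
  else if i < 4 * t - 3 then 3 else if i < 5 * t - 4 then 4 else 5

/-- Position of a vertex of the extended graph, the added vertex coming last. -/
def position {N : ℕ} : Option (Fin N) → ℕ
  | some i => i
  | none => N

theorem position_injective {N : ℕ} : Function.Injective (position (N := N)) := by
  rintro (_ | i) (_ | j) h <;> simp only [position] at h
  · rfl
  · have := j.2; omega
  · have := i.2; omega
  · rw [Fin.ext h]

theorem card_le_of_position_mem {N : ℕ} (S : Finset (Option (Fin N))) (a b c d a' b' : ℕ)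
    (h : ∀ u ∈ S, position u ∈ Ico a b ∪ Ico c d ∪ Ico a' b') :
    S.card ≤ (b - a) + (d - c) + (b' - a') := by
  have h1 := Finset.card_le_card_of_injOn position h position_injective.injOn
  have h2 := Finset.card_union_le (Ico a b) (Ico c d)
  have h3 := Finset.card_union_le (Ico a b ∪ Ico c d) (Ico a' b')
  simp only [Nat.card_Ico] at h2 h3
  omega

theorem partColor_comm : ∀ a b, partColor a b = partColor b a := by decide

theorem partColor_not_rainbow : ∀ a b d, partColor a b = partColor a d ∨
    partColor a b = partColor b d ∨ partColor a d = partColor b d := by decide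

theorem exists_extremal_coloring {N t s : ℕ} (ht : 6 ≤ t) (hN : N + 4 = 5 * t)
    (hs : s + 3 ≤ 4 * t) {k : ℕ} (hk : 3 ≤ k) :
    ∃ (A : Finset (Fin N)) (c : Option (Fin N) → Option (Fin N) → Fin k), A.card = s ∧
      (∀ a b, c a b = c b a) ∧ ¬ RainbowTri (OAdj A) c ∧
      ∀ i, ¬ MonoStar (OAdj A) c (2 * t) i := by
  obtain ⟨A, hA, hAs⟩ : ∃ A ⊆ (univ.filter fun i : Fin N => t - 1 ≤ i.1), A.card = s := by
    refine Finset.exists_subset_card_eq ?_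
    have : (univ.filter fun i : Fin N => t - 1 ≤ i.1) = Finset.Ici ⟨t - 1, by omega⟩ := by
      ext i
      simp [Fin.le_def]
    rw [this, Fin.card_Ici]
    simp only
    omega
  refine ⟨A, fun u v => Fin.castLE hk (partColor (partOf t (position u)) (partOf t (position v))),
    hAs, fun a b => congrArg _ (partColor_comm _ _), ?_, ?_⟩
  · rintro ⟨a, b, d, -, -, -, h1, h2, h3⟩
    rcases partColor_not_rainbow (partOf t (position a)) (partOf t (position b))
      (partOf t (position d)) with h | h | h
    · exact h1 (congrArg _ h)
    · exact h2 (congrArg _ h)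
    · exact h3 (congrArg _ h)
  · rintro i ⟨v, S, hS, hvS, h⟩
    have hSne : S.Nonempty := Finset.card_pos.1 (by omega)
    obtain ⟨u₀, hu₀⟩ := hSne
    have hpos : ∀ u : Option (Fin N), position u ≤ N := by
      rintro (_ | j)
      · exact le_rfl
      · exact j.2.le
    have hfacts : ∀ u ∈ S, (position v = N → t - 1 ≤ position u ∧ position u < N) ∧
        (position u = N → t - 1 ≤ position v ∧ position v < N) := by
      intro u hu
      have hadj := (h u hu).1
      have hmem : ∀ j ∈ A, t - 1 ≤ j.1 := fun j hj => (mem_filter.1 (hA hj)).2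
      rcases v with _ | x <;> rcases u with _ | y
      · exact hadj.elim
      · exact ⟨fun _ => ⟨hmem y hadj, y.2⟩, fun h' => absurd h' y.2.ne⟩
      · exact ⟨fun h' => absurd h' x.2.ne, fun _ => ⟨hmem x hadj, x.2⟩⟩
      · exact ⟨fun h' => absurd h' x.2.ne, fun h' => absurd h' y.2.ne⟩
    obtain ⟨g, hg⟩ : ∃ g, ∀ u ∈ S, partColor (partOf t (position v)) (partOf t (position u)) = g :=
      ⟨_, fun u hu => Fin.castLE_injective hk ((h u hu).2.trans (h u₀ hu₀).2.symm)⟩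
    have hv := hpos v
    have hbound := card_le_of_position_mem S
    simp only [mem_union, mem_Ico] at hbound
    generalize position v = p at hfacts hg hv
    clear h hvS
    have hparts : ∀ n, (n < t ∧ partOf t n = 0) ∨ (t ≤ n ∧ n < 2 * t - 1 ∧ partOf t n = 1) ∨
        (2 * t - 1 ≤ n ∧ n < 3 * t - 2 ∧ partOf t n = 2) ∨
        (3 * t - 2 ≤ n ∧ n < 4 * t - 3 ∧ partOf t n = 3) ∨
        (4 * t - 3 ≤ n ∧ n < 5 * t - 4 ∧ partOf t n = 4) ∨ (5 * t - 4 ≤ n ∧ partOf t n = 5) := by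
      intro n
      unfold partOf
      split_ifs <;> simp <;> omega
    have hg3 : g = 0 ∨ g = 1 ∨ g = 2 := by omega
    have hlarge : ∀ a b c d a' b', (b - a) + (d - c) + (b' - a') < 2 * t → ∃ u ∈ S,
        ¬((a ≤ position u ∧ position u < b ∨ c ≤ position u ∧ position u < d) ∨
          a' ≤ position u ∧ position u < b') := by
      intro a b c d a' b' hlt
      by_contra! hcon
      have := hbound a b c d a' b' fun u hu => by
        have := hcon u hu
        tauto
      omega
    rcases hparts p with hp | hp | hp | hp | hp | hp <;> rcases hg3 with rfl | rfl | rfl <;>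
      [obtain ⟨u, hu, hnot⟩ := hlarge t (2 * t - 1) (4 * t - 3) (5 * t - 4) (5 * t - 4) (5 * t - 3) (by omega);
       obtain ⟨u, hu, hnot⟩ := hlarge (2 * t - 1) (3 * t - 2) (3 * t - 2) (4 * t - 3) 0 0 (by omega);
       obtain ⟨u, hu, hnot⟩ := hlarge 0 t 0 0 0 0 (by omega);
       obtain ⟨u, hu, hnot⟩ := hlarge 0 t (2 * t - 1) (3 * t - 2) 0 0 (by omega);
       obtain ⟨u, hu, hnot⟩ := hlarge (3 * t - 2) (4 * t - 3) (4 * t - 3) (5 * t - 4) (5 * t - 4) (5 * t - 3) (by omega);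
       obtain ⟨u, hu, hnot⟩ := hlarge t (2 * t - 1) 0 0 0 0 (by omega);
       obtain ⟨u, hu, hnot⟩ := hlarge t (2 * t - 1) (3 * t - 2) (4 * t - 3) (5 * t - 4) (5 * t - 3) (by omega);
       obtain ⟨u, hu, hnot⟩ := hlarge 0 t (4 * t - 3) (5 * t - 4) 0 0 (by omega);
       obtain ⟨u, hu, hnot⟩ := hlarge (2 * t - 1) (3 * t - 2) 0 0 0 0 (by omega);
       obtain ⟨u, hu, hnot⟩ := hlarge (2 * t - 1) (3 * t - 2) (4 * t - 3) (5 * t - 4) (5 * t - 4) (5 * t - 3) (by omega);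
       obtain ⟨u, hu, hnot⟩ := hlarge 0 t t (2 * t - 1) 0 0 (by omega);
       obtain ⟨u, hu, hnot⟩ := hlarge (3 * t - 2) (4 * t - 3) 0 0 0 0 (by omega);
       obtain ⟨u, hu, hnot⟩ := hlarge 0 t (3 * t - 2) (4 * t - 3) 0 0 (by omega);
       obtain ⟨u, hu, hnot⟩ := hlarge t (2 * t - 1) (2 * t - 1) (3 * t - 2) (5 * t - 4) (5 * t - 3) (by omega);
       obtain ⟨u, hu, hnot⟩ := hlarge (4 * t - 3) (5 * t - 4) 0 0 0 0 (by omega);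
       obtain ⟨u, hu, hnot⟩ := hlarge (2 * t - 1) (3 * t - 2) (3 * t - 2) (4 * t - 3) (t - 1) t (by omega);
       obtain ⟨u, hu, hnot⟩ := hlarge t (2 * t - 1) (4 * t - 3) (5 * t - 4) 0 0 (by omega);
       obtain ⟨u, hu, hnot⟩ := hlarge 0 0 0 0 0 0 (by omega)] <;>
      have := hfacts u hu <;> have := hpos u <;> have hgu := hg u hu <;>
      rcases hparts (position u) with hq | hq | hq | hq | hq | hq <;>
      first
      | omega
      | exact absurd hgu (by simp only [hp, hq]; decide)

end Extremal

theorem stmt16 (k m : ℕ) (hk : 3 ≤ k) (hm : 12 ≤ m) (heven : Even m) :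
    IsLeast {s | ∀ A : Finset (Fin ((5 * m - 6) / 2 - 1)), A.card = s →
      ∀ c : Option (Fin ((5 * m - 6) / 2 - 1)) →
            Option (Fin ((5 * m - 6) / 2 - 1)) → Fin k,
        (∀ a b, c a b = c b a) →
        RainbowTri (OAdj A) c ∨ ∃ i, MonoStar (OAdj A) c m i} (2 * m - 2) := by
  obtain ⟨t, rfl⟩ := heven
  have ht : 6 ≤ t := by omega
  have hN : (5 * (t + t) - 6) / 2 - 1 + 4 = 5 * t := by omega
  generalize (5 * (t + t) - 6) / 2 - 1 = N at hN
  constructor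
  · intro A hA c hc
    by_contra! hcon
    obtain ⟨hR, hS⟩ := hcon
    have hstar : ∀ v (S : Finset (Option (Fin N))) i, v ∉ S →
        (∀ u ∈ S, OAdj A v u ∧ c v u = i) → S.card < 2 * t := by
      intro v S i hv h
      by_contra! hle
      obtain ⟨T, hT, hTc⟩ := Finset.exists_subset_card_eq hle
      exact hS i ⟨v, T, by omega, fun h' => hv (hT h'), fun u hu => h u (hT hu)⟩
    refine no_extension (c := fun x y => c (some x) (some y)) (f := fun x => c none (some x))
      (t := t) (A := A) (fun x y => hc _ _) ?_ ht (by simpa using hN) ?_ (by omega) ?_ ?_ ?_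
    · intro x y z hxy hxz hyz
      by_contra! h
      exact hR ⟨some x, some y, some z, hxy, hxz, hyz, h.1, h.2.1, h.2.2⟩
    · intro x g
      have := hstar (some x) ((Finset.univ.filter fun y =>
        y ≠ x ∧ c (some x) (some y) = g).map .some) g (by simp) (by
          simp only [Finset.mem_map, Finset.mem_filter, Finset.mem_univ, true_and]
          rintro _ ⟨y, ⟨hy, hy'⟩, rfl⟩
          exact ⟨hy.symm, hy'⟩)
      rwa [Finset.card_map] at this
    · intro g
      have := hstar none ((A.filter fun y => c none (some y) = g).map .some) g (by simp) (by
          simp only [Finset.mem_map, Finset.mem_filter]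
          rintro _ ⟨y, ⟨hy, hy'⟩, rfl⟩
          exact ⟨hy, hy'⟩)
      rwa [Finset.card_map] at this
    · intro x hx
      have := hstar (some x) (insert none ((Finset.univ.filter fun y =>
        y ≠ x ∧ c (some x) (some y) = c none (some x)).map .some)) (c none (some x))
        (by simp) (by
          simp only [Finset.mem_insert, Finset.mem_map, Finset.mem_filter, Finset.mem_univ,
            true_and]
          rintro _ (rfl | ⟨y, ⟨hy, hy'⟩, rfl⟩)
          · exact ⟨hx, hc _ _⟩
          · exact ⟨hy.symm, hy'⟩)
      rwa [Finset.card_insert_of_notMem (by simp), Finset.card_map] at this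
    · intro x hx y hy hxy
      by_contra! h
      exact hR ⟨none, some x, some y, hx, hy, hxy, h.1, h.2.1, h.2.2⟩
  · intro s hs
    by_contra! hlt
    obtain ⟨A, c, hA, hc, hR, hS⟩ := exists_extremal_coloring (N := N) (s := s) ht hN (by omega) hk
    rcases hs A hA c hc with h | ⟨i, h⟩
    · exact hR h
    · exact hS i (by rwa [← two_mul] at h)
end
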